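/- arXiv:hep-th/0303069 — 15 statements merged into one kernel-verified Lean document; each statement's English description precedes it below -/
import Mathlib

section
/- M_Λ is a finitely generated projective R-module. -/
open Polynomial Matrix

noncomputable section

set_option synthInstance.maxHeartbeats 1000000

/-- The coordinate ring of the affine rational curve obtained by gluing the
pairwise distinct points `P 0, …, P (N-1)` of `ℂ` to one point:
all polynomials `f` with `f (P 0) = f (P i)` for every `i`. -/
def nodeRing {N : ℕ} (P : Fin N → ℂ) [NeZero N] : Subalgebra ℂ (Polynomial ℂ) where
  carrier := {f | ∀ i, f.eval (P 0) = f.eval (P i)}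
  add_mem' := by intro f g hf hg i; simp [hf i, hg i]
  mul_mem' := by intro f g hf hg i; simp [hf i, hg i]
  algebraMap_mem' := by intro c i; simp

/-- The module `M_Λ` of vector-valued polynomials `s` with `s (P 0) = Λ i *ᵥ s (P i)`
for every `i ≠ 0`, as a module over the ring `nodeRing P`. -/
def nodeModule {N r : ℕ} (P : Fin N → ℂ) [NeZero N]
    (Λ : Fin N → Matrix (Fin r) (Fin r) ℂ) :
    Submodule (nodeRing P) (Fin r → Polynomial ℂ) where
  carrier := {s | ∀ i, i ≠ 0 →
    (fun j => (s j).eval (P 0)) = (Λ i) *ᵥ fun j => (s j).eval (P i)}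
  add_mem' := by
    intro s t hs ht i hi
    funext j
    have hs' := congrFun (hs i hi) j
    have ht' := congrFun (ht i hi) j
    simp only [Pi.add_apply, eval_add, mulVec, dotProduct] at hs' ht' ⊢
    rw [hs', ht', ← Finset.sum_add_distrib]
    exact Finset.sum_congr rfl fun k _ => by ring
  zero_mem' := by
    intro i hi
    funext j
    simp [mulVec, dotProduct]
  smul_mem' := by
    intro c s hs i hi
    funext j
    have hs' := congrFun (hs i hi) j
    have hc := c.2 i
    show ((c : Polynomial ℂ) * s j).eval (P 0) = _
    simp only [mulVec, dotProduct, eval_mul] at hs' ⊢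
    rw [hc, hs', Finset.mul_sum]
    refine Finset.sum_congr rfl fun k _ => ?_
    show _ = Λ i j k * ((c : Polynomial ℂ) * s k).eval (P i)
    rw [eval_mul]; ring

/-- Polynomial matrices can take prescribed values at finitely many distinct points. -/
theorem exists_matrix_map_eval_eq {ι m : Type*} [Fintype ι] [Fintype m] [DecidableEq m]
    {P : ι → ℂ}
    (hP : Function.Injective P) (V : ι → Matrix m m ℂ) :
    ∃ A : Matrix m m ℂ[X], ∀ i, (evalRingHom (P i)).mapMatrix A = V i := by
  classical
  refine ⟨Matrix.of fun j k => Lagrange.interpolate Finset.univ P fun i => V i j k, fun i => ?_⟩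
  ext j k
  simpa using Lagrange.eval_interpolate_at_node (fun i => V i j k) hP.injOn (Finset.mem_univ i)

/-- A polynomial matrix vanishing at distinct points is divisible by the product of the
corresponding linear factors. -/
theorem exists_eq_prod_smul_of_map_eval_eq_zero {ι m : Type*} [Fintype ι] [Fintype m]
    [DecidableEq m] {P : ι → ℂ}
    (hP : Function.Injective P) (D : Matrix m m ℂ[X])
    (hD : ∀ i, (evalRingHom (P i)).mapMatrix D = 0) :
    ∃ E : Matrix m m ℂ[X], D = (∏ i, (X - C (P i))) • E := by
  have h : ∀ j k, (∏ i, (X - C (P i))) ∣ D j k := fun j k =>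
    Finset.prod_dvd_of_coprime
      (fun a _ b _ hab => pairwise_coprime_X_sub_C hP hab)
      fun i _ => dvd_iff_isRoot.2 (congrFun (congrFun (hD i) j) k)
  choose E hE using h
  exact ⟨Matrix.of E, by ext1 j k; simpa using hE j k⟩

theorem eval_mulVec {m : Type*} [Fintype m] [DecidableEq m] (A : Matrix m m ℂ[X]) (s : m → ℂ[X]) (x : ℂ) :
    (fun j => ((A *ᵥ s) j).eval x) =
      (evalRingHom x).mapMatrix A *ᵥ fun j => (s j).eval x := by
  funext j
  exact RingHom.map_mulVec (evalRingHom x) A s j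

/-- A polynomial matrix sending `M_Λ` into vectors over the coordinate ring, as a linear map. -/
def nodeModuleToFree {N r : ℕ} [NeZero N] {P : Fin N → ℂ}
    {Λ : Fin N → Matrix (Fin r) (Fin r) ℂ} (A : Matrix (Fin r) (Fin r) ℂ[X])
    (hA : ∀ s ∈ nodeModule P Λ, ∀ j, (A *ᵥ s) j ∈ nodeRing P) :
    nodeModule P Λ →ₗ[nodeRing P] (Fin r → nodeRing P) where
  toFun s j := ⟨(A *ᵥ s.1) j, hA s.1 s.2 j⟩
  map_add' s t := by
    funext j
    exact Subtype.ext (congrFun (mulVec_add A s.1 t.1) j)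
  map_smul' c s := by
    funext j
    exact Subtype.ext (congrFun (mulVec_smul A (c : ℂ[X]) s.1) j)

/-- A polynomial matrix sending vectors over the coordinate ring into `M_Λ`, as a linear map. -/
def freeToNodeModule {N r : ℕ} [NeZero N] {P : Fin N → ℂ}
    {Λ : Fin N → Matrix (Fin r) (Fin r) ℂ} (A : Matrix (Fin r) (Fin r) ℂ[X])
    (hA : ∀ u : Fin r → nodeRing P, (A *ᵥ fun j => (u j : ℂ[X])) ∈ nodeModule P Λ) :
    (Fin r → nodeRing P) →ₗ[nodeRing P] nodeModule P Λ where
  toFun u := ⟨A *ᵥ fun j => (u j : ℂ[X]), hA u⟩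
  map_add' u v := Subtype.ext (mulVec_add A (fun j => (u j : ℂ[X])) fun j => (v j : ℂ[X]))
  map_smul' c u := Subtype.ext (mulVec_smul A (c : ℂ[X]) fun j => (u j : ℂ[X]))

/-- For `N ≥ 2` pairwise distinct points `P i` glued to one point and
invertible matrices `Λ i` (`i ≠ 0`), the module `M_Λ` is a finitely generated
projective module over the coordinate ring `R` of the glued curve. -/
theorem statement0 (n r : ℕ) (hr : 1 ≤ r) (P : Fin (n + 2) → ℂ)
    (hP : Function.Injective P)
    (Λ : Fin (n + 2) → Matrix (Fin r) (Fin r) ℂ)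
    (hΛ : ∀ i, i ≠ 0 → IsUnit (Λ i)) :
    Module.Finite (nodeRing P) (nodeModule P Λ) ∧
      Module.Projective (nodeRing P) (nodeModule P Λ) := by
  classical
  have hL : ∀ i, ∃ L : (Matrix (Fin r) (Fin r) ℂ)ˣ, (i = 0 → L = 1) ∧ (i ≠ 0 → L.1 = Λ i) := by
    intro i
    by_cases hi : i = 0
    · exact ⟨1, fun _ => rfl, fun h => absurd hi h⟩
    · exact ⟨(hΛ i hi).unit, fun h => absurd h hi, fun _ => rfl⟩
  choose L hL0 hLΛ using hL
  replace hL0 := hL0 0 rfl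
  obtain ⟨A, hA⟩ := exists_matrix_map_eval_eq hP fun i => (L i)⁻¹.1
  obtain ⟨B, hB⟩ := exists_matrix_map_eval_eq hP fun i => (L i).1
  obtain ⟨E, hE⟩ := exists_eq_prod_smul_of_map_eval_eq_zero hP (1 - A * B) fun i => by
    rw [map_sub, map_mul, hA, hB, map_one, Units.inv_mul, sub_self]
  set w : ℂ[X] := ∏ i, (X - C (P i)) with hw
  have hw0 : ∀ i, w.eval (P i) = 0 := fun i => by
    rw [hw, eval_prod]
    exact Finset.prod_eq_zero (Finset.mem_univ i) (by simp)
  have hw_smul : ∀ (K : Matrix (Fin r) (Fin r) ℂ[X]) i,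
      (evalRingHom (P i)).mapMatrix (w • K) = 0 := fun K i => by
    ext j k
    simp [hw0]
  have hB' : ∀ i, (evalRingHom (P i)).mapMatrix (B * (2 - A * B)) = (L i).1 := fun i => by
    rw [map_mul, map_sub, map_mul, hA, hB, Units.inv_mul, map_ofNat,
      show (2 : Matrix (Fin r) (Fin r) ℂ) - 1 = 1 by norm_num, mul_one]
  let F₁ := nodeModuleToFree (P := P) (Λ := Λ) (B * (2 - A * B)) fun s hs j i => by
    refine (congrFun (eval_mulVec _ s (P 0)) j).trans
      (Eq.trans ?_ (congrFun (eval_mulVec _ s (P i)) j).symm)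
    rw [hB', hB', hL0, Units.val_one, one_mulVec]
    by_cases hi : i = 0
    · rw [hi, hL0, Units.val_one, one_mulVec]
    · rw [hLΛ i hi, ← hs i hi]
  let F₂ := nodeModuleToFree (P := P) (Λ := Λ) (w • (E * E)) fun s _ j i => by
    refine (congrFun (eval_mulVec _ s (P 0)) j).trans
      (Eq.trans ?_ (congrFun (eval_mulVec _ s (P i)) j).symm)
    rw [hw_smul, hw_smul, zero_mulVec, zero_mulVec]
  let G₁ := freeToNodeModule (P := P) (Λ := Λ) A fun u i hi => by
    rw [eval_mulVec, eval_mulVec, hA, hA, ← hLΛ i hi, mulVec_mulVec, Units.mul_inv, hL0,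
      inv_one, Units.val_one]
    exact congrArg _ (funext fun j => (u j).2 i)
  let G₂ := freeToNodeModule (P := P) (Λ := Λ) (w • 1) fun u i _ => by
    rw [eval_mulVec, eval_mulVec, hw_smul, hw_smul, zero_mulVec, zero_mulVec, mulVec_zero]
  have hid : (G₁.coprod G₂).comp (F₁.prod F₂) = LinearMap.id := by
    refine LinearMap.ext fun s => Subtype.ext ?_
    change A *ᵥ ((B * (2 - A * B)) *ᵥ s.1) + (w • (1 : Matrix _ _ ℂ[X])) *ᵥ ((w • (E * E)) *ᵥ s.1)
      = s.1
    have hsq : (w • (1 : Matrix (Fin r) (Fin r) ℂ[X])) * (w • (E * E)) =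
        (1 - A * B) * (1 - A * B) := by
      rw [hE]
      simp only [smul_mul_assoc, mul_smul_comm, one_mul]
    rw [mulVec_mulVec, mulVec_mulVec, ← add_mulVec, hsq,
      show A * (B * (2 - A * B)) + (1 - A * B) * (1 - A * B) = 1 by noncomm_ring, one_mulVec]
  exact ⟨Module.Finite.of_surjective (G₁.coprod G₂) fun s =>
      ⟨F₁.prod F₂ s, LinearMap.congr_fun hid s⟩,
    Module.Projective.of_split (F₁.prod F₂) (G₁.coprod G₂) hid⟩

end
end

section
/- M_Λ is a finitely generated projective R-module. -/
open Polynomial Matrix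

noncomputable section

set_option synthInstance.maxHeartbeats 1000000

/-- The coordinate ring of the affine rational curve with a cusp at each of the
pairwise distinct points `P i`: all polynomials `f` with `f' (P i) = 0` for every `i`. -/
def cuspRing {N : ℕ} (P : Fin N → ℂ) : Subalgebra ℂ (Polynomial ℂ) where
  carrier := {f | ∀ i, (derivative f).eval (P i) = 0}
  add_mem' := by intro f g hf hg i; simp [hf i, hg i]
  mul_mem' := by intro f g hf hg i; simp [derivative_mul, hf i, hg i]
  algebraMap_mem' := by intro c i; simp

/-- The module `M_Λ` of vector-valued polynomials `s` with `s' (P i) = Λ i *ᵥ s (P i)`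
for every `i`, as a module over the ring `cuspRing P`. -/
def cuspModule {N r : ℕ} (P : Fin N → ℂ)
    (Λ : Fin N → Matrix (Fin r) (Fin r) ℂ) :
    Submodule (cuspRing P) (Fin r → Polynomial ℂ) where
  carrier := {s | ∀ i,
    (fun j => (derivative (s j)).eval (P i)) = (Λ i) *ᵥ fun j => (s j).eval (P i)}
  add_mem' := by
    intro s t hs ht i
    funext j
    have hs' := congrFun (hs i) j
    have ht' := congrFun (ht i) j
    simp only [Pi.add_apply, derivative_add, eval_add, mulVec, dotProduct] at hs' ht' ⊢
    rw [hs', ht', ← Finset.sum_add_distrib]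
    exact Finset.sum_congr rfl fun k _ => by ring
  zero_mem' := by
    intro i
    funext j
    simp [mulVec, dotProduct]
  smul_mem' := by
    intro c s hs i
    funext j
    have hs' := congrFun (hs i) j
    have hc := c.2 i
    show (derivative ((c : Polynomial ℂ) * s j)).eval (P i) = _
    simp only [mulVec, dotProduct, derivative_mul, eval_add, eval_mul] at hs' hc ⊢
    rw [hc, hs', Finset.mul_sum]
    simp only [zero_mul, zero_add]
    refine Finset.sum_congr rfl fun k _ => ?_
    show _ = Λ i j k * ((c : Polynomial ℂ) * s k).eval (P i)
    rw [eval_mul]; ring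

/-- Polynomials vanishing at all the nodes with prescribed first derivatives there. -/
theorem exists_eval_eq_zero_derivative_eval_eq {K ι : Type*} [Field K] [Fintype ι]
    [DecidableEq ι] (P : ι → K) (hP : Function.Injective P) (c : ι → K) :
    ∃ e : K[X], ∀ i, e.eval (P i) = 0 ∧ (derivative e).eval (P i) = c i := by
  have hbasis (i j : ι) :
      (Lagrange.basis Finset.univ P i).eval (P j) = if i = j then 1 else 0 := by
    split_ifs with h
    · subst h
      exact Lagrange.eval_basis_self hP.injOn (Finset.mem_univ _)
    · exact Lagrange.eval_basis_of_ne h (Finset.mem_univ _)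
  refine ⟨∑ i, C (c i) * ((X - C (P i)) * Lagrange.basis Finset.univ P i ^ 2), fun j => ?_⟩
  constructor
  · rw [eval_finsetSum]
    refine Finset.sum_eq_zero fun i _ => ?_
    by_cases h : i = j <;> simp [hbasis, h]
  · rw [derivative_sum, eval_finsetSum, Finset.sum_eq_single j]
    · simp [hbasis, derivative_mul]
    · intro i _ h
      simp [hbasis, h, derivative_mul, derivative_pow]
    · simp

/-- A polynomial matrix, acting on vectors, that vanishes at all the nodes
and has derivative `Λ i` at `P i`. -/
theorem exists_linearMap_eval_derivative_eval {K ι n : Type*} [Field K] [Fintype ι]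
    [Fintype n] (P : ι → K) (hP : Function.Injective P) (Λ : ι → Matrix n n K) :
    ∃ A : (n → K[X]) →ₗ[K[X]] (n → K[X]), ∀ s i j, (A s j).eval (P i) = 0 ∧
      (derivative (A s j)).eval (P i) = (Λ i *ᵥ fun k => (s k).eval (P i)) j := by
  classical
  choose e he using fun j k =>
    exists_eval_eq_zero_derivative_eval_eq P hP fun i => Λ i j k
  refine ⟨(Matrix.of e).mulVecLin, fun s i j => ?_⟩
  constructor
  · simp [mulVec, dotProduct, eval_finsetSum, he]
  · simp [mulVec, dotProduct, eval_finsetSum, derivative_mul, he]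

theorem mem_cuspModule {N r : ℕ} {P : Fin N → ℂ} {Λ : Fin N → Matrix (Fin r) (Fin r) ℂ}
    {s : Fin r → ℂ[X]} : s ∈ cuspModule P Λ ↔ ∀ i j,
      (derivative (s j)).eval (P i) = (Λ i *ᵥ fun k => (s k).eval (P i)) j :=
  forall_congr' fun _ => funext_iff

/-- For `Λ = 0` the module `M_Λ` is free. -/
def cuspModuleZeroEquiv {N : ℕ} (r : ℕ) (P : Fin N → ℂ) :
    cuspModule P (0 : Fin N → Matrix (Fin r) (Fin r) ℂ) ≃ₗ[cuspRing P]
      (Fin r → cuspRing P) where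
  toFun s j := ⟨s.1 j, fun i => by simpa using mem_cuspModule.1 s.2 i j⟩
  invFun t := ⟨fun j => (t j).1, mem_cuspModule.2 fun i j => by simpa using (t j).2 i⟩
  map_add' _ _ := rfl
  map_smul' _ _ := rfl
  left_inv _ := rfl
  right_inv _ := rfl

/-- For pairwise distinct cusp points `P i` and arbitrary matrices
`Λ i`, the module `M_Λ` is a finitely generated projective module over the
coordinate ring `R` of the cuspidal curve. -/
theorem statement1 (N r : ℕ) (hr : 1 ≤ r) (P : Fin N → ℂ)
    (hP : Function.Injective P)
    (Λ : Fin N → Matrix (Fin r) (Fin r) ℂ) :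
    Module.Finite (cuspRing P) (cuspModule P Λ) ∧
      Module.Projective (cuspRing P) (cuspModule P Λ) := by
  obtain ⟨A₀, hA⟩ := exists_linearMap_eval_derivative_eval P hP Λ
  let A : Module.End (cuspRing P) (Fin r → ℂ[X]) := A₀.restrictScalars (cuspRing P)
  have hev (s i j) : (A s j).eval (P i) = 0 := (hA s i j).1
  have hder (s i j) : (derivative (A s j)).eval (P i) =
      (Λ i *ᵥ fun k => (s k).eval (P i)) j := (hA s i j).2
  have hsq (Λ' : Fin N → Matrix (Fin r) (Fin r) ℂ) (s) : (A * A) s ∈ cuspModule P Λ' := by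
    rw [mem_cuspModule]
    intro i j
    simp [hev, hder, mulVec, dotProduct]
  have hadd {s} (hs : s ∈ cuspModule P 0) : (1 + A) s ∈ cuspModule P Λ := by
    rw [mem_cuspModule] at hs ⊢
    intro i j
    have h := hs i j
    simp_all
  have hsub {s} (hs : s ∈ cuspModule P Λ) : (1 - A) s ∈ cuspModule P 0 := by
    rw [mem_cuspModule] at hs ⊢
    intro i j
    have h := hs i j
    simp_all
  have hsub' {s} (hs : s ∈ cuspModule P Λ) :
      ((1 - A) * (1 + A * A)) s ∈ cuspModule P 0 :=
    hsub (add_mem hs (hsq Λ s))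
  let F := cuspModule P (0 : Fin N → Matrix (Fin r) (Fin r) ℂ)
  let incl : cuspModule P Λ →ₗ[cuspRing P] F × F :=
    (((1 - A) * (1 + A * A)).restrict fun _ hs => hsub' hs).prod
      ((A * A).restrict fun s _ => hsq 0 s)
  let proj : F × F →ₗ[cuspRing P] cuspModule P Λ :=
    ((1 + A).restrict fun _ hs => hadd hs).coprod ((A * A).restrict fun s _ => hsq Λ s)
  have hA4 : (1 + A) * ((1 - A) * (1 + A * A)) + (A * A) * (A * A) = 1 := by
    simp only [mul_add, add_mul, mul_sub, sub_mul, mul_assoc, one_mul, mul_one]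
    abel
  have hsplit : proj ∘ₗ incl = LinearMap.id := by
    ext1 s
    exact Subtype.ext (LinearMap.congr_fun hA4 s.1)
  have : Module.Finite (cuspRing P) F := .equiv (cuspModuleZeroEquiv r P).symm
  have : Module.Projective (cuspRing P) F := .of_equiv (cuspModuleZeroEquiv r P).symm
  exact ⟨.of_surjective proj (LinearMap.surjective_of_comp_eq_id _ _ hsplit),
    .of_split incl proj hsplit⟩

end
end

section
/- For λ ∈ ℂ, the R-submodule M_λ = {s ∈ ℂ[z] : s(P_1) = λ·s(P_2)} is a projective R-module if and only if λ ≠ 0. -/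
open Polynomial

noncomputable section

set_option synthInstance.maxHeartbeats 1000000

/-- The coordinate ring of the affine nodal rational curve obtained by gluing
the two points `P₁` and `P₂`: all polynomials `f` with `f P₁ = f P₂`. -/
def nodeRing2 (P₁ P₂ : ℂ) : Subalgebra ℂ (Polynomial ℂ) where
  carrier := {f | f.eval P₁ = f.eval P₂}
  add_mem' := by intro f g hf hg; simp_all [Set.mem_setOf_eq]
  mul_mem' := by intro f g hf hg; simp_all [Set.mem_setOf_eq]
  algebraMap_mem' := by intro c; simp

/-- The rank one module `M_λ = {s ∈ ℂ[z] : s P₁ = λ • s P₂}` over `nodeRing2 P₁ P₂`. -/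
def nodeLineModule (P₁ P₂ : ℂ) (lam : ℂ) :
    Submodule (nodeRing2 P₁ P₂) (Polynomial ℂ) where
  carrier := {s | s.eval P₁ = lam * s.eval P₂}
  add_mem' := by
    intro s t hs ht
    simp only [Set.mem_setOf_eq, eval_add] at hs ht ⊢
    rw [hs, ht]; ring
  zero_mem' := by simp
  smul_mem' := by
    intro c s hs
    have hc : (c : Polynomial ℂ).eval P₁ = (c : Polynomial ℂ).eval P₂ := c.2
    show ((c : Polynomial ℂ) * s).eval P₁ = lam * ((c : Polynomial ℂ) * s).eval P₂
    simp only [Set.mem_setOf_eq] at hs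
    rw [eval_mul, eval_mul, hc, hs]; ring

theorem mem_nodeRing2 {P₁ P₂ : ℂ} {f : ℂ[X]} :
    f ∈ nodeRing2 P₁ P₂ ↔ f.eval P₁ = f.eval P₂ := Iff.rfl

theorem mem_nodeLineModule {P₁ P₂ lam : ℂ} {s : ℂ[X]} :
    s ∈ nodeLineModule P₁ P₂ lam ↔ s.eval P₁ = lam * s.eval P₂ := Iff.rfl

/-- Multiplication by `b ∈ M_μ` as a map `M_λ → R`, when `λ μ = 1`. -/
def nodeLineModulePairing {P₁ P₂ lam mu : ℂ} (h : lam * mu = 1)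
    (b : nodeLineModule P₁ P₂ mu) :
    nodeLineModule P₁ P₂ lam →ₗ[nodeRing2 P₁ P₂] nodeRing2 P₁ P₂ where
  toFun s := ⟨(b : ℂ[X]) * s, by
    rw [mem_nodeRing2, eval_mul, eval_mul, mem_nodeLineModule.1 b.2, mem_nodeLineModule.1 s.2]
    linear_combination (eval P₂ (b : ℂ[X]) * eval P₂ (s : ℂ[X])) * h⟩
  map_add' s t := Subtype.ext (mul_add _ _ _)
  map_smul' c s := Subtype.ext (mul_left_comm (b : ℂ[X]) (c : ℂ[X]) (s : ℂ[X]))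

/-- If `1` is a sum of two products of elements of `M_λ` and `M_μ`, then `M_λ` is a direct summand
of `R²`. -/
theorem projective_nodeLineModule_of_mul_add_mul_eq_one {P₁ P₂ lam mu : ℂ} (h : lam * mu = 1)
    (a₁ a₂ : nodeLineModule P₁ P₂ lam) (b₁ b₂ : nodeLineModule P₁ P₂ mu)
    (hab : (b₁ : ℂ[X]) * a₁ + (b₂ : ℂ[X]) * a₂ = 1) :
    Module.Projective (nodeRing2 P₁ P₂) (nodeLineModule P₁ P₂ lam) := by
  refine Module.Projective.of_split
    ((nodeLineModulePairing h b₁).prod (nodeLineModulePairing h b₂))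
    ((LinearMap.toSpanSingleton _ _ a₁).coprod (LinearMap.toSpanSingleton _ _ a₂)) ?_
  refine LinearMap.ext fun s => Subtype.ext ?_
  show (b₁ : ℂ[X]) * s * a₁ + (b₂ : ℂ[X]) * s * a₂ = s
  linear_combination (s : ℂ[X]) * hab

theorem exists_eval_eq_and_eval_eq {P₁ P₂ : ℂ} (hP : P₁ ≠ P₂) (x y : ℂ) :
    ∃ f : ℂ[X], f.eval P₁ = x ∧ f.eval P₂ = y := by
  have h : P₁ - P₂ ≠ 0 := sub_ne_zero.2 hP
  refine ⟨C y + C ((x - y) / (P₁ - P₂)) * (X - C P₂), ?_, ?_⟩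
  · simp [h]
  · simp

theorem projective_nodeLineModule {P₁ P₂ lam : ℂ} (hP : P₁ ≠ P₂) (hlam : lam ≠ 0) :
    Module.Projective (nodeRing2 P₁ P₂) (nodeLineModule P₁ P₂ lam) := by
  obtain ⟨a, ha₁, ha₂⟩ := exists_eval_eq_and_eval_eq hP lam 1
  obtain ⟨b, hb₁, hb₂⟩ := exists_eval_eq_and_eval_eq hP lam⁻¹ 1
  refine projective_nodeLineModule_of_mul_add_mul_eq_one (mul_inv_cancel₀ hlam)
    ⟨a, ?_⟩ ⟨1 - a * b, ?_⟩ ⟨b * (2 - a * b), ?_⟩ ⟨1 - a * b, ?_⟩ ?_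
  · simp [mem_nodeLineModule, ha₁, ha₂]
  · simp [mem_nodeLineModule, ha₁, ha₂, hb₁, hb₂, hlam]
  · simp [mem_nodeLineModule, ha₁, ha₂, hb₁, hb₂, hlam]
  · simp [mem_nodeLineModule, ha₁, ha₂, hb₁, hb₂, hlam]
  · ring

/-- Every `R`-linear map `φ : M_0 → R` takes values vanishing at `P₁`: it commutes with
multiplication by `z`, and both `φ e` and `z * φ e` lie in `R`. -/
theorem eval_linearMap_nodeLineModule_zero {P₁ P₂ : ℂ} (hP : P₁ ≠ P₂)
    (φ : nodeLineModule P₁ P₂ 0 →ₗ[nodeRing2 P₁ P₂] nodeRing2 P₁ P₂)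
    (e : nodeLineModule P₁ P₂ 0) :
    (φ e : ℂ[X]).eval P₁ = 0 := by
  have hXe : X * (e : ℂ[X]) ∈ nodeLineModule P₁ P₂ 0 := by
    have := mem_nodeLineModule.1 e.2
    simp_all [mem_nodeLineModule]
  let c : nodeRing2 P₁ P₂ := ⟨(X - C P₁) * (X - C P₂), by simp [mem_nodeRing2]⟩
  let cX : nodeRing2 P₁ P₂ := ⟨(X - C P₁) * (X - C P₂) * X, by simp [mem_nodeRing2]⟩
  have hsmul : c • (⟨X * (e : ℂ[X]), hXe⟩ : nodeLineModule P₁ P₂ 0) = cX • e :=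
    Subtype.ext (mul_assoc ((X - C P₁) * (X - C P₂)) X (e : ℂ[X])).symm
  have hφ : (X - C P₁) * (X - C P₂) * (φ ⟨X * (e : ℂ[X]), hXe⟩ : ℂ[X]) =
      (X - C P₁) * (X - C P₂) * X * (φ e : ℂ[X]) := by
    have := congrArg φ hsmul
    rw [map_smul, map_smul] at this
    exact congrArg Subtype.val this
  have hmul : (φ ⟨X * (e : ℂ[X]), hXe⟩ : ℂ[X]) = X * (φ e : ℂ[X]) := by
    rw [mul_assoc _ X] at hφ
    exact mul_left_cancel₀ (mul_ne_zero (X_sub_C_ne_zero P₁) (X_sub_C_ne_zero P₂)) hφ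
  have h₁ : (φ e : ℂ[X]).eval P₁ = (φ e : ℂ[X]).eval P₂ := (φ e).2
  have h₂ := mem_nodeRing2.1 (φ ⟨X * (e : ℂ[X]), hXe⟩).2
  rw [hmul, eval_mul, eval_mul, eval_X, eval_X, ← h₁] at h₂
  have h₃ : (P₁ - P₂) * (φ e : ℂ[X]).eval P₁ = 0 := by linear_combination h₂
  exact (mul_eq_zero.1 h₃).resolve_left (sub_ne_zero.2 hP)

theorem not_projective_nodeLineModule_zero {P₁ P₂ : ℂ} (hP : P₁ ≠ P₂) :
    ¬ Module.Projective (nodeRing2 P₁ P₂) (nodeLineModule P₁ P₂ 0) := by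
  rintro ⟨s, hs⟩
  let e : nodeLineModule P₁ P₂ 0 := ⟨X - C P₁, by simp [mem_nodeLineModule]⟩
  have he : (e : ℂ[X]) = ∑ m ∈ (s e).support, (s e m : ℂ[X]) * (m : ℂ[X]) := by
    conv_lhs => rw [← hs e, Finsupp.linearCombination_apply, Finsupp.sum]
    rw [AddSubmonoidClass.coe_finsetSum]
    rfl
  have hd := congrArg (fun f : ℂ[X] => (derivative f).eval P₁) he
  simp only [derivative_sum, eval_finsetSum, derivative_mul, eval_add, eval_mul] at hd
  rw [Finset.sum_eq_zero] at hd
  · simp [e] at hd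
  · intro m _
    have h₁ : (s e m : ℂ[X]).eval P₁ = 0 :=
      eval_linearMap_nodeLineModule_zero hP (Finsupp.lapply m ∘ₗ s) e
    have h₂ : (m : ℂ[X]).eval P₁ = 0 := by
      simpa using mem_nodeLineModule.1 m.2
    rw [h₁, h₂, mul_zero, zero_mul, add_zero]

/-- For `P₁ ≠ P₂`, the module `M_λ` over the coordinate ring of the
nodal curve is projective if and only if `λ ≠ 0`. -/
theorem statement2 (P₁ P₂ : ℂ) (hP : P₁ ≠ P₂) (lam : ℂ) :
    Module.Projective (nodeRing2 P₁ P₂) (nodeLineModule P₁ P₂ lam) ↔ lam ≠ 0 := by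
  refine ⟨?_, projective_nodeLineModule hP⟩
  rintro h rfl
  exact not_projective_nodeLineModule_zero hP h

end
end

section
/- For a matrix polynomial Φ ∈ Mat_r(ℂ[z]), multiplication by Φ preserves M_Λ (i.e. Φ·s ∈ M_Λ for every s ∈ M_Λ) if and only if Φ'(P) = ΛΦ(P) − Φ(P)Λ, where Φ' is the entrywise derivative of Φ. -/
open Polynomial Matrix

noncomputable section

theorem eval_polynomial_mulVec {R m n : Type*} [CommSemiring R] [Fintype n]
    (P : R) (Φ : Matrix m n R[X]) (s : n → R[X]) :
    (fun j => ((Φ *ᵥ s) j).eval P) = Φ.map (eval P) *ᵥ fun j => (s j).eval P := by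
  ext i
  simp [mulVec, dotProduct, eval_finsetSum]

theorem eval_derivative_polynomial_mulVec {R m n : Type*} [CommSemiring R] [Fintype n]
    (P : R) (Φ : Matrix m n R[X]) (s : n → R[X]) :
    (fun j => (derivative ((Φ *ᵥ s) j)).eval P) =
      Φ.map (fun p => (derivative p).eval P) *ᵥ (fun j => (s j).eval P) +
        Φ.map (eval P) *ᵥ fun j => (derivative (s j)).eval P := by
  ext i
  simp [mulVec, dotProduct, eval_finsetSum, derivative_mul,
    Finset.sum_add_distrib]

/-- Let `P ∈ ℂ` be the cusp point, `Λ` a matrix, and `M_Λ` the set of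
vector-valued polynomials `s` with `s' P = Λ *ᵥ s P`.  A matrix polynomial `Φ`
preserves `M_Λ` under multiplication if and only if `Φ' P = Λ * Φ P - Φ P * Λ`,
where derivatives are taken entrywise. -/
theorem statement4 (r : ℕ) (hr : 1 ≤ r) (P : ℂ)
    (Λ : Matrix (Fin r) (Fin r) ℂ)
    (Φ : Matrix (Fin r) (Fin r) (Polynomial ℂ)) :
    (∀ s : Fin r → Polynomial ℂ,
        (fun j => (derivative (s j)).eval P) = Λ *ᵥ (fun j => (s j).eval P) →
        (fun j => (derivative ((Φ *ᵥ s) j)).eval P) = Λ *ᵥ (fun j => ((Φ *ᵥ s) j).eval P))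
      ↔ Φ.map (fun p => (derivative p).eval P)
          = Λ * Φ.map (eval P) - Φ.map (eval P) * Λ := by
  simp only [eval_derivative_polynomial_mulVec, eval_polynomial_mulVec]
  constructor
  · intro h
    rw [eq_sub_iff_add_eq]
    refine Matrix.ext_of_mulVec_single fun i => ?_
    set v : Fin r → ℂ := Pi.single i 1
    have key := h (fun j => C (v j) + C ((Λ *ᵥ v) j) * (X - C P)) (by simp)
    simpa [add_mulVec, mulVec_mulVec] using key
  · intro h s hs
    rw [hs, h]
    simp [sub_mulVec, mulVec_mulVec]

end
end

section
/- Multiplication by the matrix polynomial 1 + εχ(z) maps the set {s ∈ (ℂ[ε][z])^r : s(P_1) = Λ_i s(P_i) for i = 2,…,N} bijectively onto the set {s ∈ (ℂ[ε][z])^r : s(P_1) = Λ'_i s(P_i) for i = 2,…,N}, where Λ'_i := Λ_i + ε(χ(P_1)Λ_i − Λ_i χ(P_i)). In particular, the deformation of the module M_Λ given by the tangent class χ changes Λ_i by δ_χ Λ_i = χ(P_1)Λ_i − Λ_i χ(P_i). -/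
open Polynomial Matrix

noncomputable section

set_option synthInstance.maxHeartbeats 1000000

/-- If `e * e = 0`, then `1 + e • X` has right inverse `1 - e • X`. -/
theorem one_add_smul_mul_one_sub_smul {R m : Type*} [CommRing R] [Fintype m] [DecidableEq m]
    {e : R} (he : e * e = 0) (X : Matrix m m R) :
    (1 + e • X) * (1 - e • X) = 1 := by
  simp [add_mul, mul_sub, smul_smul, he]

/-- If `e * e = 0`, then `1 - e • X` has right inverse `1 + e • X`. -/
theorem one_sub_smul_mul_one_add_smul {R m : Type*} [CommRing R] [Fintype m] [DecidableEq m]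
    {e : R} (he : e * e = 0) (X : Matrix m m R) :
    (1 - e • X) * (1 + e • X) = 1 := by
  simp [sub_mul, mul_add, smul_sub, smul_smul, he]

/-- If `e * e = 0`, then multiplying vectors by `1 + e • X` is injective. -/
theorem mulVec_one_add_smul_injective {R m : Type*} [CommRing R] [Fintype m] [DecidableEq m]
    {e : R} (he : e * e = 0) (X : Matrix m m R) :
    Function.Injective ((1 + e • X) *ᵥ · : (m → R) → m → R) :=
  Function.LeftInverse.injective (g := ((1 - e • X) *ᵥ ·)) fun v => by
    beta_reduce
    rw [mulVec_mulVec, one_sub_smul_mul_one_add_smul he, one_mulVec]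

/-- A gluing condition `u = L *ᵥ v` is equivalent to the infinitesimally deformed one
for the transformed vectors. -/
theorem infinitesimal_gluing_iff {R m : Type*} [CommRing R] [Fintype m] [DecidableEq m]
    {e : R} (he : e * e = 0) (X Y L : Matrix m m R) (u v : m → R) :
    (1 + e • X) *ᵥ u = (L + e • (X * L - L * Y)) *ᵥ ((1 + e • Y) *ᵥ v) ↔ u = L *ᵥ v := by
  have h : (L + e • (X * L - L * Y)) * (1 + e • Y) = (1 + e • X) * L := by
    simp only [add_mul, mul_add, smul_add, smul_sub, sub_mul, mul_one, one_mul, smul_mul_assoc,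
      mul_smul_comm, smul_smul, he, zero_smul]
    abel
  rw [mulVec_mulVec, h, ← mulVec_mulVec]
  exact (mulVec_one_add_smul_injective he X).eq_iff

/-- Evaluation of the product of `1 + ε χ(z)` with a polynomial vector. -/
theorem eval_one_add_smul_mulVec {K R m : Type*} [CommRing K] [CommRing R] [Algebra K R]
    [Fintype m] [DecidableEq m] (e : R) (χ : Matrix m m K[X]) (s : m → R[X]) (a : K) :
    (fun j => (((1 + C e • χ.map (Polynomial.map (algebraMap K R))) *ᵥ s) j).eval
        (algebraMap K R a))
      = (1 + e • (χ.map (eval a)).map (algebraMap K R)) *ᵥ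
          fun j => (s j).eval (algebraMap K R a) := by
  ext j
  simp only [mulVec, dotProduct, eval_finsetSum, eval_mul, Matrix.add_apply, Matrix.smul_apply,
    Matrix.map_apply, smul_eq_mul, eval_add, eval_C, eval_map_algebraMap, aeval_algebraMap_apply,
    coe_aeval_eq_eval, Matrix.one_apply, apply_ite (eval _), eval_one, eval_zero]

/-- Over the dual numbers `ℂ[ε]` (`ε² = 0`), multiplication by the
matrix polynomial `1 + ε χ(z)` maps the set
`{s : s (P 0) = Λ i *ᵥ s (P i), i ≠ 0}` bijectively onto the corresponding set for
`Λ' i = Λ i + ε (χ(P 0) Λ i − Λ i χ(P i))`; i.e. the tangent class `χ` deforms the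
module `M_Λ` by `δ_χ Λ i = χ(P 0) Λ i − Λ i χ(P i)`. -/
theorem statement6 (n r : ℕ) (hr : 1 ≤ r) (P : Fin (n + 2) → ℂ)
    (hP : Function.Injective P)
    (Λ : Fin (n + 2) → Matrix (Fin r) (Fin r) ℂ)
    (hΛ : ∀ i, i ≠ 0 → IsUnit (Λ i))
    (χ : Matrix (Fin r) (Fin r) (Polynomial ℂ)) :
    Set.BijOn
      (fun s : Fin r → Polynomial (DualNumber ℂ) =>
        (1 + C (DualNumber.eps : DualNumber ℂ) •
            χ.map (Polynomial.map (algebraMap ℂ (DualNumber ℂ)))) *ᵥ s)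
      {s | ∀ i, i ≠ 0 →
        (fun j => (s j).eval (algebraMap ℂ (DualNumber ℂ) (P 0)))
          = ((Λ i).map (algebraMap ℂ (DualNumber ℂ))) *ᵥ
              fun j => (s j).eval (algebraMap ℂ (DualNumber ℂ) (P i))}
      {s | ∀ i, i ≠ 0 →
        (fun j => (s j).eval (algebraMap ℂ (DualNumber ℂ) (P 0)))
          = ((Λ i).map (algebraMap ℂ (DualNumber ℂ))
              + (DualNumber.eps : DualNumber ℂ) •
                ((χ.map (eval (P 0)) * Λ i - Λ i * χ.map (eval (P i))).map
                  (algebraMap ℂ (DualNumber ℂ)))) *ᵥ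
              fun j => (s j).eval (algebraMap ℂ (DualNumber ℂ) (P i))} := by
  have he : (DualNumber.eps : DualNumber ℂ) * DualNumber.eps = 0 := DualNumber.eps_mul_eps
  have hC : C (DualNumber.eps : DualNumber ℂ) * C DualNumber.eps = 0 := by
    rw [← C_mul, he, C_0]
  have gluing_iff (s : Fin r → (DualNumber ℂ)[X]) (i : Fin (n + 2)) := by
    have h := infinitesimal_gluing_iff he ((χ.map (eval (P 0))).map (algebraMap ℂ (DualNumber ℂ)))
      ((χ.map (eval (P i))).map (algebraMap ℂ (DualNumber ℂ)))
      ((Λ i).map (algebraMap ℂ (DualNumber ℂ)))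
      (fun j => (s j).eval (algebraMap ℂ (DualNumber ℂ) (P 0)))
      (fun j => (s j).eval (algebraMap ℂ (DualNumber ℂ) (P i)))
    rwa [← Matrix.map_mul, ← Matrix.map_mul, ← Matrix.map_sub _ (map_sub _),
      ← eval_one_add_smul_mulVec, ← eval_one_add_smul_mulVec] at h
  refine ⟨fun s hs i hi => (gluing_iff s i).2 (hs i hi),
    (mulVec_one_add_smul_injective (R := (DualNumber ℂ)[X]) hC _).injOn, fun t ht => ?_⟩
  have hs : (1 + C (DualNumber.eps : DualNumber ℂ) •
      χ.map (Polynomial.map (algebraMap ℂ (DualNumber ℂ)))) *ᵥ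
      ((1 - C (DualNumber.eps : DualNumber ℂ) •
        χ.map (Polynomial.map (algebraMap ℂ (DualNumber ℂ)))) *ᵥ t) = t := by
    rw [mulVec_mulVec, one_add_smul_mul_one_sub_smul (R := (DualNumber ℂ)[X]) hC, one_mulVec]
  refine ⟨_, fun i hi => (gluing_iff _ i).1 ?_, hs⟩
  rw [hs]
  exact ht i hi

end
end

section
/- Multiplication by the matrix polynomial 1 + εχ(z) maps the set {s ∈ (ℂ[ε][z])^r : s'(P) = Λ s(P)} bijectively onto the set {s ∈ (ℂ[ε][z])^r : s'(P) = Λ' s(P)}, where Λ' := Λ + ε(χ'(P) + χ(P)Λ − Λχ(P)). In particular, the deformation of the module M_Λ given by the tangent class χ changes Λ by δ_χ Λ = χ'(P) + [χ(P), Λ]. -/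
open Polynomial Matrix

noncomputable section

set_option synthInstance.maxHeartbeats 1000000

section General

variable {R n : Type*} [CommRing R]

theorem map_eval_one_add_C_smul [DecidableEq n] (e p : R) (X : Matrix n n R[X]) :
    (1 + C e • X).map (eval p) = 1 + e • X.map (eval p) := by
  ext i j
  by_cases h : i = j <;> simp [h]

theorem map_eval_derivative_one_add_C_smul [DecidableEq n] (e p : R) (X : Matrix n n R[X]) :
    ((1 + C e • X).map fun f => (derivative f).eval p) =
      e • X.map fun f => (derivative f).eval p := by
  ext i j
  by_cases h : i = j <;> simp [h]

variable [Fintype n]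

theorem eval_mulVec_s7 (M : Matrix n n R[X]) (s : n → R[X]) (p : R) :
    (fun j => ((M *ᵥ s) j).eval p) = M.map (eval p) *ᵥ fun j => (s j).eval p := by
  ext j
  simp [Matrix.mulVec, dotProduct, eval_finsetSum]

theorem eval_derivative_mulVec (M : Matrix n n R[X]) (s : n → R[X]) (p : R) :
    (fun j => (derivative ((M *ᵥ s) j)).eval p) =
      (M.map fun f => (derivative f).eval p) *ᵥ (fun j => (s j).eval p) +
        M.map (eval p) *ᵥ fun j => (derivative (s j)).eval p := by
  ext j
  simp [Matrix.mulVec, dotProduct, eval_finsetSum, Finset.sum_add_distrib]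

variable [DecidableEq n]

/-- The change of the matrix `L` in the condition `s' p = L *ᵥ s p` caused by a gauge
transformation `1 + e X` with `e * e = 0`. -/
theorem eval_derivative_one_add_C_smul_mulVec {e : R} (he : e * e = 0) (p : R)
    (L : Matrix n n R) (X : Matrix n n R[X]) {s : n → R[X]}
    (hs : (fun j => (derivative (s j)).eval p) = L *ᵥ fun j => (s j).eval p) :
    (fun j => (derivative (((1 + C e • X) *ᵥ s) j)).eval p) =
      (L + e • (X.map (fun f => (derivative f).eval p) + X.map (eval p) * L
        - L * X.map (eval p))) *ᵥ fun j => (((1 + C e • X) *ᵥ s) j).eval p := by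
  rw [eval_derivative_mulVec, eval_mulVec_s7, hs, map_eval_one_add_C_smul,
    map_eval_derivative_one_add_C_smul, Matrix.mulVec_mulVec, Matrix.mulVec_mulVec,
    ← Matrix.add_mulVec]
  congr 1
  simp only [add_mul, sub_mul, mul_add, one_mul, mul_one, Matrix.smul_mul, Matrix.mul_smul,
    smul_smul, he,
    zero_smul, smul_add, smul_sub]
  abel

theorem one_add_C_smul_mul_one_add_C_smul_neg {e : R} (he : e * e = 0) (X : Matrix n n R[X]) :
    (1 + C e • X) * (1 + C e • -X) = 1 := by
  simp only [add_mul, mul_add, one_mul, mul_one, Matrix.smul_mul, Matrix.mul_smul, smul_smul,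
    ← C_mul, he, C_0, zero_smul, smul_neg, mul_neg]
  abel

theorem bijOn_one_add_C_smul_mulVec {e : R} (he : e * e = 0) (p : R)
    (L : Matrix n n R) (X : Matrix n n R[X]) :
    Set.BijOn (fun s : n → R[X] => (1 + C e • X) *ᵥ s)
      {s | (fun j => (derivative (s j)).eval p) = L *ᵥ fun j => (s j).eval p}
      {s | (fun j => (derivative (s j)).eval p) =
        (L + e • (X.map (fun f => (derivative f).eval p) + X.map (eval p) * L
          - L * X.map (eval p))) *ᵥ fun j => (s j).eval p} := by
  refine Set.InvOn.bijOn (f' := fun s => (1 + C e • -X) *ᵥ s) ⟨fun s _ => ?_, fun s _ => ?_⟩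
    (fun s hs => eval_derivative_one_add_C_smul_mulVec he p L X hs) fun s hs => ?_
  · have h := one_add_C_smul_mul_one_add_C_smul_neg he (-X)
    rw [neg_neg] at h
    simp only [Matrix.mulVec_mulVec, h, Matrix.one_mulVec]
  · simp only [Matrix.mulVec_mulVec, one_add_C_smul_mul_one_add_C_smul_neg he,
      Matrix.one_mulVec]
  · refine (eval_derivative_one_add_C_smul_mulVec he p _ (-X) hs).trans ?_
    congr 1
    have hd : ((-X).map fun f => (derivative f).eval p) =
        -X.map fun f => (derivative f).eval p := by ext; simp
    have hv : (-X).map (eval p) = -X.map (eval p) := by ext; simp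
    rw [hd, hv]
    simp only [add_mul, mul_add, sub_mul, mul_sub, neg_mul, mul_neg, Matrix.smul_mul,
      Matrix.mul_smul, smul_smul, he, zero_smul, smul_add, smul_sub, smul_neg]
    abel

end General

/-- Over the dual numbers `ℂ[ε]` (`ε² = 0`), multiplication by the
matrix polynomial `1 + ε χ(z)` maps the set `{s : s' P = Λ *ᵥ s P}` bijectively onto
the corresponding set for `Λ' = Λ + ε (χ'(P) + χ(P) Λ − Λ χ(P))`; i.e. the tangent
class `χ` deforms the module `M_Λ` by `δ_χ Λ = χ'(P) + [χ(P), Λ]`. -/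
theorem statement7 (r : ℕ) (hr : 1 ≤ r) (P : ℂ)
    (Λ : Matrix (Fin r) (Fin r) ℂ)
    (χ : Matrix (Fin r) (Fin r) (Polynomial ℂ)) :
    Set.BijOn
      (fun s : Fin r → Polynomial (DualNumber ℂ) =>
        (1 + C (DualNumber.eps : DualNumber ℂ) •
            χ.map (Polynomial.map (algebraMap ℂ (DualNumber ℂ)))) *ᵥ s)
      {s | (fun j => (derivative (s j)).eval (algebraMap ℂ (DualNumber ℂ) P))
          = (Λ.map (algebraMap ℂ (DualNumber ℂ))) *ᵥ
              fun j => (s j).eval (algebraMap ℂ (DualNumber ℂ) P)}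
      {s | (fun j => (derivative (s j)).eval (algebraMap ℂ (DualNumber ℂ) P))
          = (Λ.map (algebraMap ℂ (DualNumber ℂ))
              + (DualNumber.eps : DualNumber ℂ) •
                ((χ.map (fun p => (derivative p).eval P)
                    + χ.map (eval P) * Λ - Λ * χ.map (eval P)).map
                  (algebraMap ℂ (DualNumber ℂ)))) *ᵥ
              fun j => (s j).eval (algebraMap ℂ (DualNumber ℂ) P)} := by
  have hd : (χ.map (fun p => (derivative p).eval P)).map (algebraMap ℂ (DualNumber ℂ)) =
      (χ.map (Polynomial.map (algebraMap ℂ (DualNumber ℂ)))).map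
        fun f => (derivative f).eval (algebraMap ℂ (DualNumber ℂ) P) := by
    ext1 i j
    simp only [Matrix.map_apply, derivative_map, eval_map_apply]
  have hv : (χ.map (eval P)).map (algebraMap ℂ (DualNumber ℂ)) =
      (χ.map (Polynomial.map (algebraMap ℂ (DualNumber ℂ)))).map
        (eval (algebraMap ℂ (DualNumber ℂ) P)) := by
    ext1 i j
    simp only [Matrix.map_apply, eval_map_apply]
  rw [Matrix.map_sub _ (map_sub _), Matrix.map_add _ (map_add _), Matrix.map_mul,
    Matrix.map_mul, hd, hv]
  exact bijOn_one_add_C_smul_mulVec DualNumber.eps_mul_eps _ _ _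

end
end

section
/- Let Φ_2(z), …, Φ_N(z) ∈ Mat_r(ℂ[z]) be matrix polynomials each satisfying Φ_i(P_1) = Λ_k Φ_i(P_k) Λ_k^{-1} for all k = 2, …, N. Set B_i := (P_i − P_1)^{-1} Φ_i(P_i) for i = 2, …, N and B_1 := −Σ_{i=2}^{N} Λ_i B_i Λ_i^{-1}. Then the matrix-valued rational function Σ_{i=2}^{N} Φ_i(z) / ((z−P_1)(z−P_i)) − Σ_{i=1}^{N} B_i / (z−P_i) is a matrix polynomial (it has no poles). In other words, every section Σ_{i=2}^{N} Φ_i(z)·ω_i of End(M_Λ)⊗K over the affine chart, with ω_i = dz/((z−P_1)(z−P_i)), equals Σ_{i=1}^{N} B_i dz/(z−P_i) up to a holomorphic term, where B_1 = −Σ_{i≥2} Λ_i B_i Λ_i^{-1}. -/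
open Polynomial Matrix

noncomputable section

set_option synthInstance.maxHeartbeats 1000000

/-- Partial fractions: subtracting the polar parts of `f / ((X - a) (X - b))` leaves a polynomial. -/
theorem partialFraction_mem_range {a b : ℂ} (hab : a ≠ b) (f : Polynomial ℂ) :
    (algebraMap (Polynomial ℂ) (RatFunc ℂ) ((X - C a) * (X - C b)))⁻¹ *
        algebraMap (Polynomial ℂ) (RatFunc ℂ) f
      - (algebraMap (Polynomial ℂ) (RatFunc ℂ) (X - C b))⁻¹ *
        algebraMap ℂ (RatFunc ℂ) ((b - a)⁻¹ * f.eval b)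
      + (algebraMap (Polynomial ℂ) (RatFunc ℂ) (X - C a))⁻¹ *
        algebraMap ℂ (RatFunc ℂ) ((b - a)⁻¹ * f.eval a)
      ∈ (algebraMap (Polynomial ℂ) (RatFunc ℂ)).range := by
  have hba : b - a ≠ 0 := sub_ne_zero.mpr hab.symm
  obtain ⟨g, hg⟩ : (X - C a) * (X - C b) ∣
      f - C ((b - a)⁻¹ * f.eval b) * (X - C a) + C ((b - a)⁻¹ * f.eval a) * (X - C b) := by
    apply (isCoprime_X_sub_C_of_isUnit_sub (sub_ne_zero.mpr hab).isUnit).mul_dvd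
    · rw [dvd_iff_isRoot]
      simp only [IsRoot, eval_add, eval_sub, eval_mul, eval_C, eval_X]
      field_simp
      ring
    · rw [dvd_iff_isRoot]
      simp only [IsRoot, eval_add, eval_sub, eval_mul, eval_C, eval_X]
      field_simp
      ring
  refine ⟨g, ?_⟩
  have ha : algebraMap (Polynomial ℂ) (RatFunc ℂ) (X - C a) ≠ 0 :=
    RatFunc.algebraMap_ne_zero (X_sub_C_ne_zero a)
  have hb : algebraMap (Polynomial ℂ) (RatFunc ℂ) (X - C b) ≠ 0 :=
    RatFunc.algebraMap_ne_zero (X_sub_C_ne_zero b)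
  have hg' := congrArg (algebraMap (Polynomial ℂ) (RatFunc ℂ)) hg
  have hC (c : ℂ) : algebraMap ℂ (RatFunc ℂ) c = algebraMap (Polynomial ℂ) (RatFunc ℂ) (C c) :=
    IsScalarTower.algebraMap_apply ℂ (Polynomial ℂ) (RatFunc ℂ) c
  rw [hC, hC]
  generalize C ((b - a)⁻¹ * f.eval b) = p at *
  generalize C ((b - a)⁻¹ * f.eval a) = q at *
  simp only [map_add, map_sub (algebraMap (Polynomial ℂ) (RatFunc ℂ)) f, map_mul] at hg' ⊢
  generalize algebraMap (Polynomial ℂ) (RatFunc ℂ) (X - C a) = u at *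
  generalize algebraMap (Polynomial ℂ) (RatFunc ℂ) (X - C b) = v at *
  field_simp
  linear_combination -hg'

/-- Let `Φ i` (`i ≠ 0`) be matrix polynomials, each an endomorphism
of `M_Λ` over the affine chart (`Φ i (P 0) = Λ k * Φ i (P k) * (Λ k)⁻¹` for all
`k ≠ 0`).  With `B i = (P i − P 0)⁻¹ • Φ i (P i)` for `i ≠ 0` and
`B 0 = −∑_{i ≠ 0} Λ i * B i * (Λ i)⁻¹`, the matrix-valued rational function
`∑_{i ≠ 0} Φ i (z) / ((z − P 0)(z − P i)) − ∑ i B i / (z − P i)`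
has all its entries in `ℂ[z]`, i.e. it is a matrix polynomial. -/
theorem statement9 (n r : ℕ) (hr : 1 ≤ r) (P : Fin (n + 2) → ℂ)
    (hP : Function.Injective P)
    (Λ : Fin (n + 2) → Matrix (Fin r) (Fin r) ℂ)
    (hΛ : ∀ i, i ≠ 0 → IsUnit (Λ i))
    (Φ : Fin (n + 2) → Matrix (Fin r) (Fin r) (Polynomial ℂ))
    (hΦ : ∀ i, i ≠ 0 → ∀ k, k ≠ 0 →
      (Φ i).map (eval (P 0)) = Λ k * (Φ i).map (eval (P k)) * (Λ k)⁻¹)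
    (B : Fin (n + 2) → Matrix (Fin r) (Fin r) ℂ)
    (hB : ∀ i, i ≠ 0 → B i = (P i - P 0)⁻¹ • (Φ i).map (eval (P i)))
    (hB0 : B 0 = -∑ i ∈ Finset.univ.erase 0, Λ i * B i * (Λ i)⁻¹) :
    ∀ j l,
      ((∑ i ∈ Finset.univ.erase 0,
          (algebraMap (Polynomial ℂ) (RatFunc ℂ) ((X - C (P 0)) * (X - C (P i))))⁻¹ •
            (Φ i).map (algebraMap (Polynomial ℂ) (RatFunc ℂ))
        - ∑ i, (algebraMap (Polynomial ℂ) (RatFunc ℂ) (X - C (P i)))⁻¹ •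
            (B i).map (algebraMap ℂ (RatFunc ℂ))) j l)
        ∈ (algebraMap (Polynomial ℂ) (RatFunc ℂ)).range := by
  intro j l
  have hB0' : B 0 j l =
      -∑ i ∈ Finset.univ.erase 0, (P i - P 0)⁻¹ * ((Φ i) j l).eval (P 0) := by
    rw [hB0, Matrix.neg_apply, Matrix.sum_apply]
    congr 1
    refine Finset.sum_congr rfl fun i hi => ?_
    have hi0 := Finset.ne_of_mem_erase hi
    rw [hB i hi0, Matrix.mul_smul, Matrix.smul_mul, ← hΦ i hi0 i hi0]
    simp
  rw [← Finset.add_sum_erase _ _ (Finset.mem_univ (0 : Fin (n + 2)))]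
  simp only [Matrix.sub_apply, Matrix.add_apply, Matrix.sum_apply, Matrix.smul_apply,
    Matrix.map_apply, smul_eq_mul]
  rw [hB0', map_neg, map_sum, mul_neg, Finset.mul_sum, sub_add_eq_sub_sub_swap, sub_neg_eq_add,
    ← Finset.sum_sub_distrib, ← Finset.sum_add_distrib]
  refine Subring.sum_mem _ fun i hi => ?_
  have hi0 := Finset.ne_of_mem_erase hi
  rw [hB i hi0]
  exact partialFraction_mem_range (hP.ne hi0.symm) (Φ i j l)

end
end

section
/- Let A ≠ B be complex numbers and Λ ∈ GL_n(ℂ). In the 2n²-dimensional complex vector space W of matrix polynomials χ(z) = χ_0 + χ_1 z of degree at most 1 in Mat_n(ℂ[z]), let V_1 be the subspace of constant matrix polynomials and V_2 := {Θ(z−A) − ΛΘΛ^{-1}(z−B) : Θ ∈ Mat_n(ℂ)}. Then V_1 ∩ V_2 = {(B−A)Θ : Θ ∈ Mat_n(ℂ), ΘΛ = ΛΘ}, and consequently dim_ℂ (W / (V_1 + V_2)) = dim_ℂ {X ∈ Mat_n(ℂ) : XΛ = ΛX}. (This expresses dim H^1(End(M_Λ)) = dim H^0(End(M_Λ)) for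 the nodal curve obtained by gluing A and B.) -/
open Polynomial Matrix

noncomputable section

set_option synthInstance.maxHeartbeats 1000000

/-- The linear embedding `Θ ↦ Θ` of constant matrix polynomials. -/
def constM (n : ℕ) : Matrix (Fin n) (Fin n) ℂ →ₗ[ℂ] Matrix (Fin n) (Fin n) (Polynomial ℂ) :=
  (Algebra.linearMap ℂ (Polynomial ℂ)).mapMatrix

/-- The linear map `Θ ↦ Θ (z − A) − Λ Θ Λ⁻¹ (z − B)`. -/
def v2map (n : ℕ) (A B : ℂ) (Λ : Matrix (Fin n) (Fin n) ℂ) :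
    Matrix (Fin n) (Fin n) ℂ →ₗ[ℂ] Matrix (Fin n) (Fin n) (Polynomial ℂ) :=
  (X - C A) • constM n -
    (X - C B) • ((constM n) ∘ₗ (LinearMap.mulRight ℂ Λ⁻¹ ∘ₗ LinearMap.mulLeft ℂ Λ))

/-- The linear map `(χ₀, χ₁) ↦ χ₀ + χ₁ z`, whose range is the space `W` of matrix
polynomials of degree at most `1`. -/
def wmap (n : ℕ) : (Matrix (Fin n) (Fin n) ℂ × Matrix (Fin n) (Fin n) ℂ) →ₗ[ℂ]
    Matrix (Fin n) (Fin n) (Polynomial ℂ) :=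
  (constM n) ∘ₗ LinearMap.fst ℂ _ _ + (X : Polynomial ℂ) • ((constM n) ∘ₗ LinearMap.snd ℂ _ _)

/-- The linear map `Y ↦ Y Λ − Λ Y`, whose kernel is the commutant of `Λ`. -/
def commMap (n : ℕ) (Λ : Matrix (Fin n) (Fin n) ℂ) :
    Matrix (Fin n) (Fin n) ℂ →ₗ[ℂ] Matrix (Fin n) (Fin n) ℂ :=
  LinearMap.mulRight ℂ Λ - LinearMap.mulLeft ℂ Λ

/-- The linear map `Θ ↦ Θ − Λ Θ Λ⁻¹`. -/
def conjDefect (n : ℕ) (Λ : Matrix (Fin n) (Fin n) ℂ) :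
    Matrix (Fin n) (Fin n) ℂ →ₗ[ℂ] Matrix (Fin n) (Fin n) ℂ :=
  LinearMap.id - LinearMap.mulRight ℂ Λ⁻¹ ∘ₗ LinearMap.mulLeft ℂ Λ

/-- The linear map taking a matrix polynomial to its coefficient of degree `k`. -/
def coeffM (n k : ℕ) : Matrix (Fin n) (Fin n) (Polynomial ℂ) →ₗ[ℂ] Matrix (Fin n) (Fin n) ℂ :=
  (Polynomial.lcoeff ℂ k).mapMatrix

theorem conjDefect_apply {n : ℕ} (Λ Θ : Matrix (Fin n) (Fin n) ℂ) :
    conjDefect n Λ Θ = Θ - Λ * Θ * Λ⁻¹ := rfl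

theorem constM_eq_map {n : ℕ} (M : Matrix (Fin n) (Fin n) ℂ) : constM n M = M.map C := rfl

theorem coeffM_zero_wmap {n : ℕ} (p : Matrix (Fin n) (Fin n) ℂ × Matrix (Fin n) (Fin n) ℂ) :
    coeffM n 0 (wmap n p) = p.1 := by
  ext i j
  simp [coeffM, wmap, constM]

theorem coeffM_one_wmap {n : ℕ} (p : Matrix (Fin n) (Fin n) ℂ × Matrix (Fin n) (Fin n) ℂ) :
    coeffM n 1 (wmap n p) = p.2 := by
  ext i j
  simp [coeffM, wmap, constM, coeff_C]

theorem wmap_injective (n : ℕ) : Function.Injective (wmap n) := fun p q h =>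
  Prod.ext (by rw [← coeffM_zero_wmap p, h, coeffM_zero_wmap])
    (by rw [← coeffM_one_wmap p, h, coeffM_one_wmap])

theorem constM_eq_wmap {n : ℕ} (M : Matrix (Fin n) (Fin n) ℂ) : constM n M = wmap n (M, 0) := by
  simp [wmap]

theorem v2map_eq_wmap {n : ℕ} (A B : ℂ) (Λ Θ : Matrix (Fin n) (Fin n) ℂ) :
    v2map n A B Λ Θ = wmap n (B • (Λ * Θ * Λ⁻¹) - A • Θ, conjDefect n Λ Θ) := by
  ext1 i j
  simp [v2map, wmap, constM, conjDefect_apply]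
  ring

theorem conjDefect_eq_zero_iff {n : ℕ} {Λ : Matrix (Fin n) (Fin n) ℂ} (hΛ : IsUnit Λ)
    (Θ : Matrix (Fin n) (Fin n) ℂ) : conjDefect n Λ Θ = 0 ↔ Θ * Λ = Λ * Θ := by
  have hdet : IsUnit Λ.det := (Matrix.isUnit_iff_isUnit_det Λ).1 hΛ
  rw [conjDefect_apply, sub_eq_zero]
  constructor
  · intro h
    calc Θ * Λ = Λ * Θ * Λ⁻¹ * Λ := by rw [← h]
      _ = Λ * Θ := Matrix.nonsing_inv_mul_cancel_right _ _ hdet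
  · intro h
    rw [← h, Matrix.mul_nonsing_inv_cancel_right _ _ hdet]

theorem ker_conjDefect {n : ℕ} {Λ : Matrix (Fin n) (Fin n) ℂ} (hΛ : IsUnit Λ) :
    LinearMap.ker (conjDefect n Λ) = LinearMap.ker (commMap n Λ) := by
  ext Θ
  simp [conjDefect_eq_zero_iff hΛ, commMap, sub_eq_zero]

theorem range_constM_inf_range_v2map {n : ℕ} (A B : ℂ) {Λ : Matrix (Fin n) (Fin n) ℂ}
    (hΛ : IsUnit Λ) :
    ((LinearMap.range (constM n) ⊓ LinearMap.range (v2map n A B Λ) :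
        Submodule ℂ (Matrix (Fin n) (Fin n) (Polynomial ℂ))) : Set _)
      = {χ | ∃ Θ : Matrix (Fin n) (Fin n) ℂ,
          Θ * Λ = Λ * Θ ∧ χ = ((B - A) • Θ).map C} := by
  have key : ∀ Θ : Matrix (Fin n) (Fin n) ℂ, conjDefect n Λ Θ = 0 →
      v2map n A B Λ Θ = ((B - A) • Θ).map C := by
    intro Θ h
    have h' : Λ * Θ * Λ⁻¹ = Θ := (sub_eq_zero.1 (conjDefect_apply Λ Θ ▸ h)).symm
    rw [v2map_eq_wmap, h, h', ← sub_smul, ← constM_eq_wmap, constM_eq_map]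
  ext χ
  constructor
  · rintro ⟨⟨M, hM⟩, Θ, rfl⟩
    have h : conjDefect n Λ Θ = 0 := by
      rw [constM_eq_wmap, v2map_eq_wmap] at hM
      exact (congrArg Prod.snd (wmap_injective n hM)).symm
    exact ⟨Θ, (conjDefect_eq_zero_iff hΛ Θ).1 h, key Θ h⟩
  · rintro ⟨Θ, h, rfl⟩
    exact ⟨⟨_, constM_eq_map _⟩, Θ, key Θ ((conjDefect_eq_zero_iff hΛ Θ).2 h)⟩

theorem wmap_mem_sup_iff {n : ℕ} (A B : ℂ) (Λ : Matrix (Fin n) (Fin n) ℂ)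
    (p : Matrix (Fin n) (Fin n) ℂ × Matrix (Fin n) (Fin n) ℂ) :
    wmap n p ∈ LinearMap.range (constM n) ⊔ LinearMap.range (v2map n A B Λ) ↔
      p.2 ∈ LinearMap.range (conjDefect n Λ) := by
  constructor
  · intro h
    obtain ⟨_, ⟨M, rfl⟩, _, ⟨Θ, rfl⟩, h⟩ := Submodule.mem_sup.1 h
    rw [constM_eq_wmap, v2map_eq_wmap, ← map_add] at h
    exact ⟨Θ, by simpa using congrArg Prod.snd (wmap_injective n h)⟩
  · rintro ⟨Θ, h⟩
    refine Submodule.mem_sup.2 ⟨_, ⟨p.1 - (B • (Λ * Θ * Λ⁻¹) - A • Θ), rfl⟩, _, ⟨Θ, rfl⟩, ?_⟩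
    rw [constM_eq_wmap, v2map_eq_wmap, ← map_add, h]
    simp

theorem finrank_quotient_sup {n : ℕ} (A B : ℂ) {Λ : Matrix (Fin n) (Fin n) ℂ}
    (hΛ : IsUnit Λ) :
    Module.finrank ℂ
        (↥(LinearMap.range (wmap n)) ⧸
          ((LinearMap.range (constM n) ⊔ LinearMap.range (v2map n A B Λ)).comap
            (LinearMap.range (wmap n)).subtype))
      = Module.finrank ℂ ↥(LinearMap.ker (commMap n Λ)) := by
  let φ : ↥(LinearMap.range (wmap n)) →ₗ[ℂ]
      (Matrix (Fin n) (Fin n) ℂ ⧸ LinearMap.range (conjDefect n Λ)) :=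
    (LinearMap.range (conjDefect n Λ)).mkQ ∘ₗ coeffM n 1 ∘ₗ (LinearMap.range (wmap n)).subtype
  have hφ : Function.Surjective φ := by
    intro y
    obtain ⟨M, rfl⟩ := Submodule.mkQ_surjective _ y
    refine ⟨⟨wmap n (0, M), _, rfl⟩, ?_⟩
    simp [φ, coeffM_one_wmap]
  have hker : (LinearMap.range (constM n) ⊔ LinearMap.range (v2map n A B Λ)).comap
      (LinearMap.range (wmap n)).subtype = LinearMap.ker φ := by
    ext ⟨_, p, rfl⟩
    rw [Submodule.mem_comap, Submodule.subtype_apply, wmap_mem_sup_iff, LinearMap.mem_ker]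
    simp only [φ, LinearMap.comp_apply, Submodule.subtype_apply, coeffM_one_wmap,
      Submodule.mkQ_apply, Submodule.Quotient.mk_eq_zero]
  rw [hker, (φ.quotKerEquivOfSurjective hφ).finrank_eq, ← ker_conjDefect hΛ]
  have h₁ := (LinearMap.range (conjDefect n Λ)).finrank_quotient_add_finrank
  have h₂ := (conjDefect n Λ).finrank_range_add_finrank_ker
  omega

/-- In the space `W` of matrix polynomials of degree at most `1`
(the range of `wmap n`), with `V₁` the subspace of constants (range of `constM n`) and
`V₂ = {Θ(z−A) − ΛΘΛ⁻¹(z−B)}` (range of `v2map n A B Λ`):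
`V₁ ⊓ V₂ = {(B−A) • Θ : ΘΛ = ΛΘ}`, and
`dim (W / (V₁ + V₂)) = dim {X : XΛ = ΛX}`. -/
theorem statement10 (n : ℕ) (A B : ℂ) (hAB : A ≠ B)
    (Λ : Matrix (Fin n) (Fin n) ℂ) (hΛ : IsUnit Λ) :
    (((LinearMap.range (constM n) ⊓ LinearMap.range (v2map n A B Λ) :
        Submodule ℂ (Matrix (Fin n) (Fin n) (Polynomial ℂ))) : Set _)
      = {χ | ∃ Θ : Matrix (Fin n) (Fin n) ℂ,
          Θ * Λ = Λ * Θ ∧ χ = ((B - A) • Θ).map C}) ∧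
    Module.finrank ℂ
        (↥(LinearMap.range (wmap n)) ⧸
          ((LinearMap.range (constM n) ⊔ LinearMap.range (v2map n A B Λ)).comap
            (LinearMap.range (wmap n)).subtype))
      = Module.finrank ℂ ↥(LinearMap.ker (commMap n Λ)) := by
  exact ⟨range_constM_inf_range_v2map A B hΛ, finrank_quotient_sup A B hΛ⟩

end
end

section
/- Tr(Φ_1²) = Σ_{i=1}^{n} p_i² − (1/4)·Σ_{i≠j} f_{ij} f_{ji} / sinh²(x_i − x_j). (This is, up to normalization, the Hamiltonian of the trigonometric Calogero–Moser system with spin, arising as Tr Φ² for the Hitchin system on the nodal rational curve with one marked point.) -/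
open Matrix

noncomputable section

theorem Complex.exp_two_mul_sub_one (z : ℂ) :
    Complex.exp (2 * z) - 1 = 2 * Complex.exp z * Complex.sinh z := by
  rw [Complex.sinh, two_mul, Complex.exp_add, Complex.exp_neg]
  field_simp [Complex.exp_ne_zero z]

theorem Matrix.inv_diagonal_exp_mul_mul_diagonal_exp_apply {ι : Type*} [Fintype ι] [DecidableEq ι]
    (y : ι → ℂ) (A : Matrix ι ι ℂ) (i j : ι) :
    ((Matrix.diagonal fun i => Complex.exp (y i))⁻¹ * A *
      Matrix.diagonal fun i => Complex.exp (y i)) i j = Complex.exp (y j - y i) * A i j := by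
  have hinv : (Matrix.diagonal fun i => Complex.exp (y i))⁻¹ =
      Matrix.diagonal fun i => Complex.exp (-y i) := by
    refine Matrix.inv_eq_left_inv ?_
    simp [Matrix.diagonal_mul_diagonal, ← Complex.exp_add]
  rw [hinv, Matrix.mul_diagonal, Matrix.diagonal_mul, sub_eq_add_neg, Complex.exp_add]
  ring

theorem Complex.sinh_sub_ne_zero {a b : ℂ} (h : Complex.exp (2 * a) ≠ Complex.exp (2 * b)) :
    Complex.sinh (a - b) ≠ 0 := by
  intro hs
  have hexp := Complex.exp_two_mul_sub_one (a - b)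
  rw [hs, mul_zero, sub_eq_zero, mul_sub, Complex.exp_sub,
    div_eq_one_iff_eq (Complex.exp_ne_zero _)] at hexp
  exact h hexp

/-- The trigonometric Calogero–Moser Hamiltonian with spin:
with `Λ = diag(e^{2x_i})`, `Φ₂ = Λ⁻¹ Φ₁ Λ`, `Φ₃ = Φ₂ − Φ₁`, `p_i = (Φ₁)_{ii}` and
`f_{ij} = (Φ₃)_{ij}`, one has
`Tr Φ₁² = ∑ p_i² − (1/4) ∑_{i≠j} f_{ij} f_{ji} / sinh²(x_i − x_j)`. -/
theorem statement11 (n : ℕ) (hn : 1 ≤ n) (x : Fin n → ℂ)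
    (hx : Function.Injective fun i => Complex.exp (2 * x i))
    (Φ₁ Φ₂ Φ₃ : Matrix (Fin n) (Fin n) ℂ)
    (hΦ₂ : Φ₂ = (Matrix.diagonal fun i => Complex.exp (2 * x i))⁻¹ * Φ₁ *
      Matrix.diagonal fun i => Complex.exp (2 * x i))
    (hΦ₃ : Φ₃ = Φ₂ - Φ₁) :
    Matrix.trace (Φ₁ * Φ₁) =
      (∑ i, Φ₁ i i ^ 2) -
        (1 / 4 : ℂ) * ∑ i, ∑ j ∈ Finset.univ.erase i,
          Φ₃ i j * Φ₃ j i / Complex.sinh (x i - x j) ^ 2 := by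
  have hΦ₃_apply (i j : Fin n) : Φ₃ i j =
      2 * Complex.exp (x j - x i) * Complex.sinh (x j - x i) * Φ₁ i j := by
    rw [hΦ₃, hΦ₂, Matrix.sub_apply, Matrix.inv_diagonal_exp_mul_mul_diagonal_exp_apply,
      ← Complex.exp_two_mul_sub_one, mul_sub]
    ring
  have hterm (i j : Fin n) (hij : j ≠ i) :
      Φ₃ i j * Φ₃ j i / Complex.sinh (x i - x j) ^ 2 = -4 * (Φ₁ i j * Φ₁ j i) := by
    have hsinh := Complex.sinh_sub_ne_zero (hx.ne hij.symm)
    have hexp : Complex.exp (x j - x i) * Complex.exp (x i - x j) = 1 := by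
      simp [← Complex.exp_add]
    rw [hΦ₃_apply, hΦ₃_apply, ← neg_sub (x i) (x j), Complex.sinh_neg,
      div_eq_iff (pow_ne_zero 2 hsinh), neg_sub]
    linear_combination
      (-4 * Complex.sinh (x i - x j) ^ 2 * Φ₁ i j * Φ₁ j i) * hexp
  rw [Finset.mul_sum, ← Finset.sum_sub_distrib, Matrix.trace]
  refine Finset.sum_congr rfl fun i _ => ?_
  rw [Matrix.diag_apply, Matrix.mul_apply, ← Finset.add_sum_erase _ _ (Finset.mem_univ i),
    Finset.sum_congr rfl fun j hj => hterm i j (Finset.ne_of_mem_erase hj), ← Finset.mul_sum]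
  ring

end
end

section
/- Tr(Φ_1²) − Tr(Φ_1 Φ_2) = (1/2)·Σ_{i≠j} f_{ij} f_{ji} = (1/2)·Tr(Φ_3²); that is, the difference of the two trigonometric Hamiltonians equals (up to normalization) the quadratic Casimir element of the spin matrix Φ_3. -/
open Matrix

noncomputable section

/-- For a matrix with vanishing diagonal, the off-diagonal part of `Tr A²` is all of it. -/
theorem sum_erase_mul_eq_trace_mul_self {ι R : Type*} [Fintype ι] [DecidableEq ι] [Semiring R]
    (A : Matrix ι ι R) (hA : ∀ i, A i i = 0) :
    ∑ i, ∑ j ∈ Finset.univ.erase i, A i j * A j i = Matrix.trace (A * A) := by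
  simp only [Matrix.trace, Matrix.diag_apply, Matrix.mul_apply]
  exact Finset.sum_congr rfl fun i _ => Finset.sum_erase _ (by simp [hA])

/-- If `B` has the same `Tr B²` as `A`, then `Tr (B - A)² = 2 (Tr A² - Tr AB)`. -/
theorem trace_sub_mul_sub_self {ι R : Type*} [Fintype ι] [CommRing R]
    (A B : Matrix ι ι R) (h : Matrix.trace (B * B) = Matrix.trace (A * A)) :
    Matrix.trace ((B - A) * (B - A)) = 2 * (Matrix.trace (A * A) - Matrix.trace (A * B)) := by
  simp only [sub_mul, mul_sub, Matrix.trace_sub, h, Matrix.trace_mul_comm B A]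
  ring

/-- With `Λ = diag(e^{2x_i})`, `Φ₂ = Λ⁻¹ Φ₁ Λ`, `Φ₃ = Φ₂ − Φ₁` and
`f_{ij} = (Φ₃)_{ij}`, the difference of the two trigonometric Hamiltonians is the
quadratic Casimir of the spin matrix:
`Tr Φ₁² − Tr (Φ₁ Φ₂) = (1/2) ∑_{i≠j} f_{ij} f_{ji} = (1/2) Tr Φ₃²`. -/
theorem statement13 (n : ℕ) (hn : 1 ≤ n) (x : Fin n → ℂ)
    (hx : Function.Injective fun i => Complex.exp (2 * x i))
    (Φ₁ Φ₂ Φ₃ : Matrix (Fin n) (Fin n) ℂ)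
    (hΦ₂ : Φ₂ = (Matrix.diagonal fun i => Complex.exp (2 * x i))⁻¹ * Φ₁ *
      Matrix.diagonal fun i => Complex.exp (2 * x i))
    (hΦ₃ : Φ₃ = Φ₂ - Φ₁) :
    Matrix.trace (Φ₁ * Φ₁) - Matrix.trace (Φ₁ * Φ₂) =
        (1 / 2 : ℂ) * ∑ i, ∑ j ∈ Finset.univ.erase i, Φ₃ i j * Φ₃ j i ∧
      (1 / 2 : ℂ) * (∑ i, ∑ j ∈ Finset.univ.erase i, Φ₃ i j * Φ₃ j i) =
        (1 / 2 : ℂ) * Matrix.trace (Φ₃ * Φ₃) := by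
  set d : Fin n → ℂ := fun i => Complex.exp (2 * x i)
  have hd0 (i) : d i ≠ 0 := Complex.exp_ne_zero _
  have hdet : IsUnit (Matrix.diagonal d).det := by
    simp [Matrix.det_diagonal, Finset.prod_ne_zero_iff, hd0]
  have hinv : (Matrix.diagonal d)⁻¹ = Matrix.diagonal fun i => (d i)⁻¹ :=
    Matrix.inv_eq_left_inv (by simp [Matrix.diagonal_mul_diagonal, hd0])
  have hdiag (i) : Φ₃ i i = 0 := by
    rw [hΦ₃, hΦ₂, hinv, Matrix.sub_apply, Matrix.mul_diagonal, Matrix.diagonal_mul]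
    field_simp [hd0]
    ring
  have hsq : Matrix.trace (Φ₂ * Φ₂) = Matrix.trace (Φ₁ * Φ₁) := by
    have : Φ₂ * Φ₂ = (Matrix.diagonal d)⁻¹ * (Φ₁ * Φ₁ * Matrix.diagonal d) := by
      rw [hΦ₂]
      simp only [Matrix.mul_assoc, Matrix.mul_nonsing_inv_cancel_left _ _ hdet]
    rw [this, Matrix.trace_mul_comm, Matrix.mul_nonsing_inv_cancel_right _ _ hdet]
  rw [sum_erase_mul_eq_trace_mul_self Φ₃ hdiag, hΦ₃, trace_sub_mul_sub_self Φ₁ Φ₂ hsq]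
  exact ⟨by ring, rfl⟩

end
end

section
/- Let Λ_1, Λ_2 ∈ Mat_2(ℂ) be traceless matrices with Tr(([Λ_1, Λ_2])²) ≠ 0, and let Φ_1, Φ_2 ∈ Mat_2(ℂ) be traceless matrices satisfying [Λ_1, Φ_1] + [Λ_2, Φ_2] = 0. Then there exist complex numbers p_1, p_2, p_3 such that Φ_1 = 2p_1 Λ_1 + p_2 Λ_2 and Φ_2 = p_2 Λ_1 + 2p_3 Λ_2. (In particular Φ_1 and Φ_2 are linear combinations of Λ_1 and Λ_2 and the cross coefficients p_{12}, p_{21} coincide.) -/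
open Matrix

noncomputable section

/-- Expansion of a traceless `2×2` matrix `X` in terms of the traceless matrices `A`, `B` and
their commutator, which span the traceless matrices when `Tr([A,B]²)` is invertible. -/
theorem trace_commutator_sq_smul_eq {R : Type*} [CommRing R] (A B X : Matrix (Fin 2) (Fin 2) R)
    (hA : A.trace = 0) (hB : B.trace = 0) (hX : X.trace = 0) :
    ((A * B - B * A) * (A * B - B * A)).trace • X =
      ((X * B - B * X) * (A * B - B * A)).trace • A +
        ((A * X - X * A) * (A * B - B * A)).trace • B +
        (X * (A * B - B * A)).trace • (A * B - B * A) := by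
  rw [trace_fin_two, add_comm, add_eq_zero_iff_eq_neg] at hA hB hX
  ext i j
  fin_cases i <;> fin_cases j <;>
    simp [trace_fin_two, mul_apply, Fin.sum_univ_two, hA, hB, hX] <;> ring

/-- Cyclicity of the trace: the triple product of `X`, `A`, `B` depends only on `[A, X]`
and `B`. -/
theorem trace_mul_commutator {n R : Type*} [Fintype n] [CommRing R] (A B X : Matrix n n R) :
    (X * (A * B - B * A)).trace = -((A * X - X * A) * B).trace := by
  simp only [mul_sub, sub_mul, trace_sub, ← mul_assoc]
  rw [trace_mul_cycle X B A, neg_sub]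

/-- Let `Λ₁, Λ₂` be traceless `2×2` complex matrices with
`Tr([Λ₁,Λ₂]²) ≠ 0`, and let `Φ₁, Φ₂` be traceless matrices with
`[Λ₁,Φ₁] + [Λ₂,Φ₂] = 0`.  Then `Φ₁ = 2p₁Λ₁ + p₂Λ₂` and `Φ₂ = p₂Λ₁ + 2p₃Λ₂`
for some complex numbers `p₁, p₂, p₃`. -/
theorem statement15 (Λ₁ Λ₂ Φ₁ Φ₂ : Matrix (Fin 2) (Fin 2) ℂ)
    (hΛ₁ : Matrix.trace Λ₁ = 0) (hΛ₂ : Matrix.trace Λ₂ = 0)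
    (hnd : Matrix.trace ((Λ₁ * Λ₂ - Λ₂ * Λ₁) * (Λ₁ * Λ₂ - Λ₂ * Λ₁)) ≠ 0)
    (hΦ₁ : Matrix.trace Φ₁ = 0) (hΦ₂ : Matrix.trace Φ₂ = 0)
    (hmom : (Λ₁ * Φ₁ - Φ₁ * Λ₁) + (Λ₂ * Φ₂ - Φ₂ * Λ₂) = 0) :
    ∃ p₁ p₂ p₃ : ℂ,
      Φ₁ = (2 * p₁) • Λ₁ + p₂ • Λ₂ ∧ Φ₂ = p₂ • Λ₁ + (2 * p₃) • Λ₂ := by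
  have h₁₂ : Λ₁ * Φ₁ - Φ₁ * Λ₁ = Φ₂ * Λ₂ - Λ₂ * Φ₂ := by
    rw [eq_neg_of_add_eq_zero_left hmom, neg_sub]
  have hN₁ : (Φ₁ * (Λ₁ * Λ₂ - Λ₂ * Λ₁)).trace = 0 := by
    rw [trace_mul_commutator, h₁₂, sub_mul, trace_sub, mul_assoc Λ₂, trace_mul_comm Λ₂, sub_self,
      neg_zero]
  have hN₂ : (Φ₂ * (Λ₁ * Λ₂ - Λ₂ * Λ₁)).trace = 0 := by
    rw [← neg_sub (Λ₂ * Λ₁), mul_neg, trace_neg, trace_mul_commutator, ← neg_sub (Φ₂ * Λ₂), ← h₁₂,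
      neg_mul, trace_neg, sub_mul, trace_sub, mul_assoc Λ₁, trace_mul_comm Λ₁, sub_self,
      neg_neg, neg_zero]
  have e₁ := trace_commutator_sq_smul_eq Λ₁ Λ₂ Φ₁ hΛ₁ hΛ₂ hΦ₁
  have e₂ := trace_commutator_sq_smul_eq Λ₁ Λ₂ Φ₂ hΛ₁ hΛ₂ hΦ₂
  rw [hN₁, zero_smul, add_zero, ← eq_inv_smul_iff₀ hnd, smul_add, smul_smul, smul_smul] at e₁
  rw [hN₂, zero_smul, add_zero, ← eq_inv_smul_iff₀ hnd, smul_add, smul_smul, smul_smul,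
    ← h₁₂] at e₂
  obtain ⟨a, b, c, h₁, h₂⟩ : ∃ a b c : ℂ, Φ₁ = a • Λ₁ + b • Λ₂ ∧ Φ₂ = b • Λ₁ + c • Λ₂ :=
    ⟨_, _, _, e₁, e₂⟩
  refine ⟨a / 2, b, c / 2, ?_, ?_⟩
  · rwa [mul_div_cancel₀ _ two_ne_zero]
  · rwa [mul_div_cancel₀ _ two_ne_zero]

end
end

section
/- Let Λ_1, Λ_2 ∈ Mat_2(ℂ) be traceless, let p_1, p_2, p_3, c ∈ ℂ, set Φ_1 := 2p_1 Λ_1 + p_2 Λ_2 and Φ_2 := p_2 Λ_1 + 2p_3 Λ_2, and let t_1 := Tr(Λ_1²), t_2 := Tr(Λ_1Λ_2), t_3 := Tr(Λ_2²). Then the quadratic Hitchin Hamiltonians of the two-cusp genus-2 curve are: (a) H_1 := Tr(Φ_1²) = 4p_1²t_1 + p_2²t_3 + 4p_1p_2t_2; (b) H_2 := 2Tr(Φ_1Φ_2) + c²·Tr(([Λ_1, Φ_1])²) = 4p_1p_2t_1 + 4p_2p_3t_3 + (8p_1p_3 + 2p_2²)t_2 − 2c²p_2²(t_1t_3 − t_2²);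 (c) H_3 := Tr(Φ_2²) = 4p_3²t_3 + p_2²t_1 + 4p_2p_3t_2. -/
open Matrix

noncomputable section

/-- Quadratic Hitchin Hamiltonians of the two-cusp genus-2 curve:
with `Λ₁, Λ₂` traceless `2×2` matrices, `Φ₁ = 2p₁Λ₁ + p₂Λ₂`, `Φ₂ = p₂Λ₁ + 2p₃Λ₂`,
`t₁ = Tr Λ₁²`, `t₂ = Tr (Λ₁Λ₂)`, `t₃ = Tr Λ₂²` and `c = z₁ − z₂`:
(a) `Tr Φ₁² = 4p₁²t₁ + p₂²t₃ + 4p₁p₂t₂`;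
(b) `2Tr(Φ₁Φ₂) + c² Tr([Λ₁,Φ₁]²) = 4p₁p₂t₁ + 4p₂p₃t₃ + (8p₁p₃ + 2p₂²)t₂ − 2c²p₂²(t₁t₃ − t₂²)`;
(c) `Tr Φ₂² = 4p₃²t₃ + p₂²t₁ + 4p₂p₃t₂`. -/
theorem statement16 (Λ₁ Λ₂ : Matrix (Fin 2) (Fin 2) ℂ)
    (hΛ₁ : Matrix.trace Λ₁ = 0) (hΛ₂ : Matrix.trace Λ₂ = 0)
    (p₁ p₂ p₃ c : ℂ)
    (Φ₁ Φ₂ : Matrix (Fin 2) (Fin 2) ℂ)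
    (hΦ₁ : Φ₁ = (2 * p₁) • Λ₁ + p₂ • Λ₂)
    (hΦ₂ : Φ₂ = p₂ • Λ₁ + (2 * p₃) • Λ₂)
    (t₁ t₂ t₃ : ℂ)
    (ht₁ : t₁ = Matrix.trace (Λ₁ * Λ₁))
    (ht₂ : t₂ = Matrix.trace (Λ₁ * Λ₂))
    (ht₃ : t₃ = Matrix.trace (Λ₂ * Λ₂)) :
    Matrix.trace (Φ₁ * Φ₁) = 4 * p₁ ^ 2 * t₁ + p₂ ^ 2 * t₃ + 4 * p₁ * p₂ * t₂ ∧
      2 * Matrix.trace (Φ₁ * Φ₂) +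
          c ^ 2 * Matrix.trace ((Λ₁ * Φ₁ - Φ₁ * Λ₁) * (Λ₁ * Φ₁ - Φ₁ * Λ₁))
        = 4 * p₁ * p₂ * t₁ + 4 * p₂ * p₃ * t₃ + (8 * p₁ * p₃ + 2 * p₂ ^ 2) * t₂
            - 2 * c ^ 2 * p₂ ^ 2 * (t₁ * t₃ - t₂ ^ 2) ∧
      Matrix.trace (Φ₂ * Φ₂) = 4 * p₃ ^ 2 * t₃ + p₂ ^ 2 * t₁ + 4 * p₂ * p₃ * t₂ := by
  rw [Matrix.trace_fin_two] at hΛ₁ hΛ₂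
  have h₁ : Λ₁ 1 1 = -Λ₁ 0 0 := by linear_combination hΛ₁
  have h₂ : Λ₂ 1 1 = -Λ₂ 0 0 := by linear_combination hΛ₂
  subst hΦ₁ hΦ₂ ht₁ ht₂ ht₃
  simp only [Matrix.trace_fin_two, Matrix.mul_apply, Fin.sum_univ_two, Matrix.add_apply,
    Matrix.sub_apply, Matrix.smul_apply, smul_eq_mul, h₁, h₂]
  refine ⟨?_, ?_, ?_⟩ <;> ring

end
end

section
/- The polynomials H_1, H_2, H_3 pairwise Poisson-commute: for all a, b ∈ {1,2,3}, Σ_{i=1}^{3} (∂H_a/∂p_i · ∂H_b/∂t_i − ∂H_a/∂t_i · ∂H_b/∂p_i) = 0. Hence the quadratic Hitchin Hamiltonians of the two-cusp genus-2 curve form an integrable system. -/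
open MvPolynomial

noncomputable section

/-- The variable `t i` in `ℂ[t₁,t₂,t₃,p₁,p₂,p₃]`. -/
def tv (i : Fin 3) : MvPolynomial (Fin 3 ⊕ Fin 3) ℂ := X (Sum.inl i)

/-- The variable `p i` in `ℂ[t₁,t₂,t₃,p₁,p₂,p₃]`. -/
def pv (i : Fin 3) : MvPolynomial (Fin 3 ⊕ Fin 3) ℂ := X (Sum.inr i)

/-- The canonical Poisson bracket `{F,G} = ∑ i (∂F/∂pᵢ ∂G/∂tᵢ − ∂F/∂tᵢ ∂G/∂pᵢ)`. -/
def pbracket (F G : MvPolynomial (Fin 3 ⊕ Fin 3) ℂ) : MvPolynomial (Fin 3 ⊕ Fin 3) ℂ :=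
  ∑ i : Fin 3,
    (pderiv (Sum.inr i) F * pderiv (Sum.inl i) G -
      pderiv (Sum.inl i) F * pderiv (Sum.inr i) G)

/-- The quadratic Hitchin Hamiltonians of the two-cusp genus-2 curve,
with parameter `c = z₁ − z₂`. -/
def Ham (c : ℂ) : Fin 3 → MvPolynomial (Fin 3 ⊕ Fin 3) ℂ
  | 0 => 4 * pv 0 ^ 2 * tv 0 + pv 1 ^ 2 * tv 2 + 4 * pv 0 * pv 1 * tv 1
  | 1 => 4 * pv 0 * pv 1 * tv 0 + 4 * pv 1 * pv 2 * tv 2 +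
      (8 * pv 0 * pv 2 + 2 * pv 1 ^ 2) * tv 1 -
      2 * C (c ^ 2) * pv 1 ^ 2 * (tv 0 * tv 2 - tv 1 ^ 2)
  | 2 => 4 * pv 2 ^ 2 * tv 2 + pv 1 ^ 2 * tv 0 + 4 * pv 1 * pv 2 * tv 1

theorem pderiv_ofNat {σ R : Type*} [CommSemiring R] (i : σ) (n : ℕ) [n.AtLeastTwo] :
    pderiv i (ofNat(n) : MvPolynomial σ R) = 0 :=
  (pderiv i).map_natCast n

/-- The three quadratic Hitchin Hamiltonians `H₁, H₂, H₃` of the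
two-cusp genus-2 curve pairwise Poisson-commute:
`∑ i (∂H_a/∂pᵢ ∂H_b/∂tᵢ − ∂H_a/∂tᵢ ∂H_b/∂pᵢ) = 0` for all `a, b`. -/
theorem statement17 (c : ℂ) (a b : Fin 3) :
    pbracket (Ham c a) (Ham c b) = 0 := by
  fin_cases a <;> fin_cases b <;>
    simp [pbracket, Ham, Fin.sum_univ_three, tv, pv, pderiv_X, pderiv_ofNat, Pi.single_apply,
      Derivation.leibniz_pow] <;>
    ring

end
end

section
/- Let Λ_1, Λ_2 ∈ Mat_2(ℂ) be traceless, let λ, μ, z_1, z_2 ∈ ℂ, and set t_1 := Tr(Λ_1²), t_2 := Tr(Λ_1Λ_2), t_3 := Tr(Λ_2²). Then the determinant of the 4×4 block matrix with blocks [[Λ_1 + λ·1, z_1(Λ_1 + λ·1) + 1], [Λ_2 + μ·1, z_2(Λ_2 + μ·1) + 1]] (where 1 is the 2×2 identity) equals (t_1 t_3 / 4)(z_1 − z_2)² + t_2 − (t_1/2)(μ(z_1 − z_2) − 1)² − (t_3/2)(λ(z_1 − z_2) + 1)² + (λμ(z_1 − z_2) − λ + μ)². (This determinant is the consistency condition defining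 the Narasimhan–Ramanan divisor D_E of the bundle E = M_Λ on the rational curve with two cusps, and exhibits τ_1 = t_1, τ_2 = t_2 + (t_1t_3/4)(z_1−z_2)², τ_3 = t_3 as affine analogs of the Narasimhan–Ramanan parameters.) -/
open Matrix

noncomputable section

/-- A block determinant whose second block column is an affine function of the first one
reduces to a determinant of half the size. -/
theorem det_fromBlocks_smul_add_one (A B : Matrix (Fin 2) (Fin 2) ℂ) (z₁ z₂ : ℂ) :
    (Matrix.fromBlocks A (z₁ • A + 1) B (z₂ • B + 1)).det
      = (B - A + (z₁ - z₂) • (B * A)).det := by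
  have h : Matrix.fromBlocks A (z₁ • A + 1) B (z₂ • B + 1)
        * Matrix.fromBlocks (-(z₁ • (1 : Matrix (Fin 2) (Fin 2) ℂ))) (1 + z₁ • A) 1 (-A)
      = Matrix.fromBlocks 1 0 ((z₂ - z₁) • B + 1) (B - A + (z₁ - z₂) • (B * A)) := by
    simp only [Matrix.fromBlocks_multiply]
    congr 1 <;> simp [add_mul, mul_add] <;> module
  have h₁ : (Matrix.fromBlocks (-(z₁ • (1 : Matrix (Fin 2) (Fin 2) ℂ)))
      (1 + z₁ • A) 1 (-A)).det = 1 := by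
    have h₂ : Matrix.fromBlocks (-(z₁ • (1 : Matrix (Fin 2) (Fin 2) ℂ))) (1 + z₁ • A) 1 (-A)
        = Matrix.fromBlocks 1 (-((1 + z₁) • (1 : Matrix (Fin 2) (Fin 2) ℂ))) 0 1
          * Matrix.fromBlocks 1 (1 - A) 1 (-A) := by
      simp only [Matrix.fromBlocks_multiply]
      congr 1 <;> simp <;> module
    rw [h₂, Matrix.det_mul, Matrix.det_fromBlocks_zero₂₁, Matrix.det_fromBlocks_one₁₁]
    have h₄ : -A - 1 * (1 - A) = -1 := by
      rw [one_mul]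
      abel
    simp only [h₄, Matrix.det_neg, Matrix.det_one]
    simp
  have h₃ := congrArg Matrix.det h
  rwa [Matrix.det_mul, h₁, mul_one, Matrix.det_fromBlocks_zero₁₂, Matrix.det_one, one_mul] at h₃

/-- The Narasimhan–Ramanan determinant for the rational curve with
two cusps: for traceless `2×2` matrices `Λ₁, Λ₂`, with `t₁ = Tr Λ₁²`,
`t₂ = Tr (Λ₁Λ₂)`, `t₃ = Tr Λ₂²`, the determinant of the block matrix
`[[Λ₁ + λ·1, z₁(Λ₁ + λ·1) + 1], [Λ₂ + μ·1, z₂(Λ₂ + μ·1) + 1]]` equals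
`(t₁t₃/4)(z₁−z₂)² + t₂ − (t₁/2)(μ(z₁−z₂)−1)² − (t₃/2)(λ(z₁−z₂)+1)²
  + (λμ(z₁−z₂) − λ + μ)²`. -/
theorem statement18 (Λ₁ Λ₂ : Matrix (Fin 2) (Fin 2) ℂ)
    (hΛ₁ : Matrix.trace Λ₁ = 0) (hΛ₂ : Matrix.trace Λ₂ = 0)
    (lam mu z₁ z₂ : ℂ)
    (t₁ t₂ t₃ : ℂ)
    (ht₁ : t₁ = Matrix.trace (Λ₁ * Λ₁))
    (ht₂ : t₂ = Matrix.trace (Λ₁ * Λ₂))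
    (ht₃ : t₃ = Matrix.trace (Λ₂ * Λ₂)) :
    (Matrix.fromBlocks
        (Λ₁ + lam • (1 : Matrix (Fin 2) (Fin 2) ℂ))
        (z₁ • (Λ₁ + lam • (1 : Matrix (Fin 2) (Fin 2) ℂ)) + 1)
        (Λ₂ + mu • (1 : Matrix (Fin 2) (Fin 2) ℂ))
        (z₂ • (Λ₂ + mu • (1 : Matrix (Fin 2) (Fin 2) ℂ)) + 1)).det
      = (t₁ * t₃ / 4) * (z₁ - z₂) ^ 2 + t₂
          - (t₁ / 2) * (mu * (z₁ - z₂) - 1) ^ 2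
          - (t₃ / 2) * (lam * (z₁ - z₂) + 1) ^ 2
          + (lam * mu * (z₁ - z₂) - lam + mu) ^ 2 := by
  rw [det_fromBlocks_smul_add_one, ht₁, ht₂, ht₃]
  have h₁ : Λ₁ 1 1 = -Λ₁ 0 0 := by
    rw [Matrix.trace_fin_two] at hΛ₁
    linear_combination hΛ₁
  have h₂ : Λ₂ 1 1 = -Λ₂ 0 0 := by
    rw [Matrix.trace_fin_two] at hΛ₂
    linear_combination hΛ₂
  simp [Matrix.trace_fin_two, Matrix.det_fin_two, Matrix.mul_apply, Fin.sum_univ_two, h₁, h₂]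
  ring

end
end

section
/- Let A ≠ B be complex numbers and Λ ∈ GL_r(ℂ). A matrix polynomial Φ ∈ Mat_r(ℂ[z]) satisfies Φ(A) = Λ Φ(B) Λ^{-1} if and only if there exist a constant matrix Θ ∈ Mat_r(ℂ) and a matrix polynomial Ψ ∈ Mat_r(ℂ[z]) such that Φ(z) = Θ(z − A) − ΛΘΛ^{-1}(z − B) + (z − A)(z − B)Ψ(z). (This is the normal form for endomorphisms of the module M_Λ over the nodal curve obtained by gluing the points A and B.) -/
open Polynomial Matrix

noncomputable section

theorem X_sub_C_mul_X_sub_C_dvd {K : Type*} [Field K] {a b : K} (hab : a ≠ b) {p : K[X]}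
    (ha : p.eval a = 0) (hb : p.eval b = 0) : (X - C a) * (X - C b) ∣ p :=
  (isCoprime_X_sub_C_of_isUnit_sub (sub_ne_zero.2 hab).isUnit).mul_dvd
    (dvd_iff_isRoot.2 ha) (dvd_iff_isRoot.2 hb)

/-- Normal form for endomorphisms of the module `M_Λ` on the nodal
curve glued from `A ≠ B`: a matrix polynomial `Φ` satisfies `Φ(A) = Λ Φ(B) Λ⁻¹`
if and only if
`Φ(z) = Θ(z − A) − ΛΘΛ⁻¹(z − B) + (z − A)(z − B)Ψ(z)`
for some constant matrix `Θ` and some matrix polynomial `Ψ`. -/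
theorem statement19 (r : ℕ) (A B : ℂ) (hAB : A ≠ B)
    (Λ : Matrix (Fin r) (Fin r) ℂ) (hΛ : IsUnit Λ)
    (Φ : Matrix (Fin r) (Fin r) (Polynomial ℂ)) :
    Φ.map (eval A) = Λ * Φ.map (eval B) * Λ⁻¹ ↔
      ∃ (Θ : Matrix (Fin r) (Fin r) ℂ) (Ψ : Matrix (Fin r) (Fin r) (Polynomial ℂ)),
        Φ = (X - C A) • Θ.map C - (X - C B) • (Λ * Θ * Λ⁻¹).map C
            + ((X - C A) * (X - C B)) • Ψ := by
  have hBA : B - A ≠ 0 := sub_ne_zero.2 hAB.symm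
  constructor
  · intro h
    set Θ : Matrix (Fin r) (Fin r) ℂ := (B - A)⁻¹ • Φ.map (eval B) with hΘ
    have hΛΘ : Λ * Θ * Λ⁻¹ = (B - A)⁻¹ • Φ.map (eval A) := by
      rw [h, hΘ, Matrix.mul_smul, Matrix.smul_mul]
    have key : ∀ i j, (X - C A) * (X - C B) ∣
        Φ i j - ((X - C A) * C (Θ i j) - (X - C B) * C ((Λ * Θ * Λ⁻¹) i j)) := by
      intro i j
      rw [hΛΘ, hΘ]
      apply X_sub_C_mul_X_sub_C_dvd hAB
      · simp only [eval_sub, eval_mul, eval_X, eval_C, Matrix.smul_apply, Matrix.map_apply,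
          smul_eq_mul]
        field_simp
        ring
      · simp only [eval_sub, eval_mul, eval_X, eval_C, Matrix.smul_apply, Matrix.map_apply,
          smul_eq_mul]
        field_simp
        ring
    choose Ψ hΨ using key
    refine ⟨Θ, Matrix.of Ψ, ?_⟩
    ext1 i j
    simp only [Matrix.add_apply, Matrix.sub_apply, Matrix.smul_apply, Matrix.map_apply,
      Matrix.of_apply, smul_eq_mul, ← hΨ]
    ring
  · rintro ⟨Θ, Ψ, rfl⟩
    have hA : ((X - C A) • Θ.map C - (X - C B) • (Λ * Θ * Λ⁻¹).map C
        + ((X - C A) * (X - C B)) • Ψ).map (eval A) = (B - A) • (Λ * Θ * Λ⁻¹) := by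
      ext i j
      simp only [Matrix.add_apply, Matrix.sub_apply, Matrix.smul_apply, Matrix.map_apply,
        smul_eq_mul, eval_add, eval_sub, eval_mul, eval_X, eval_C]
      ring
    have hB : ((X - C A) • Θ.map C - (X - C B) • (Λ * Θ * Λ⁻¹).map C
        + ((X - C A) * (X - C B)) • Ψ).map (eval B) = (B - A) • Θ := by
      ext i j
      simp only [Matrix.add_apply, Matrix.sub_apply, Matrix.smul_apply, Matrix.map_apply,
        smul_eq_mul, eval_add, eval_sub, eval_mul, eval_X, eval_C]
      ring
    rw [hA, hB, Matrix.mul_smul, Matrix.smul_mul]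

end
end
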